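/- arXiv:1211.0627 — 5 statements merged into one kernel-verified Lean document; each statement's English description precedes it below -/
import Mathlib

section
/- Let G be a finite simple 3-connected graph and let h(G) be its Hadwiger number. Then C(h(G),3) - C(h(G),2) + C(h(G),1) ≤ |C(G)| - |E(G)| + |V(G)|, where C(n,k) denotes the binomial coefficient and C(G) is the set of induced nonseparating cycles of G. -/
open SimpleGraph

variable {V : Type*} {W : Type*}

/-- A graph is 3-connected if deleting any set of at most two vertices
leaves a connected graph. -/
def ThreeConnected (G : SimpleGraph V) : Prop :=
  ∀ S : Set V, S.ncard ≤ 2 → (G.induce Sᶜ).Connected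

/-- `C` induces a cycle in `G`: the induced subgraph on `C` is connected,
`2`-regular and has at least three vertices. -/
def IsInducedCycle (G : SimpleGraph V) (C : Set V) : Prop :=
  3 ≤ C.ncard ∧ (G.induce C).Connected ∧
    ∀ x : C, ((G.induce C).neighborSet x).ncard = 2

/-- `C` is an induced nonseparating cycle of `G`: deleting `V(C)` leaves a
connected graph (the empty graph counts as connected). -/
def IsNonsepCycle (G : SimpleGraph V) (C : Set V) : Prop :=
  IsInducedCycle G C ∧ (G.induce Cᶜ).Preconnected

/-- The set `C(G)` of induced nonseparating cycles of `G`. -/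
def nonsepCycles (G : SimpleGraph V) : Set (Set V) :=
  {C | IsNonsepCycle G C}

/-- `H` is a minor of `G`: there is a minor model assigning to each vertex of `H`
a nonempty connected branch set in `G`, pairwise disjoint, with edges of `H`
realized by edges between the corresponding branch sets. -/
def IsMinor (H : SimpleGraph W) (G : SimpleGraph V) : Prop :=
  ∃ f : W → Set V, (∀ i, (f i).Nonempty) ∧ (∀ i, (G.induce (f i)).Connected) ∧
    (Pairwise fun i j => Disjoint (f i) (f j)) ∧
    ∀ i j, H.Adj i j → ∃ a ∈ f i, ∃ b ∈ f j, G.Adj a b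

/-- The Hadwiger number of `G`: the largest `n` such that the complete graph
`K_n` is a minor of `G`. -/
noncomputable def hadwigerNumber (G : SimpleGraph V) : ℕ :=
  sSup {n | IsMinor (⊤ : SimpleGraph (Fin n)) G}

/-- `F` is a proper nonempty part of `A` with no edge of `G` to the rest of `A`. -/
def Splits (G : SimpleGraph V) (A F : Set V) : Prop :=
  F ⊆ A ∧ F.Nonempty ∧ (A \ F).Nonempty ∧ ∀ x ∈ F, ∀ y ∈ A \ F, ¬ G.Adj x y

theorem Splits.compl {G : SimpleGraph V} {A F : Set V} (h : Splits G A F) :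
    Splits G A (A \ F) := by
  obtain ⟨hs, hne, hne', hadj⟩ := h
  refine ⟨Set.sdiff_subset, hne', ?_, ?_⟩
  · rwa [Set.sdiff_sdiff_cancel_left hs]
  · rw [Set.sdiff_sdiff_cancel_left hs]
    exact fun x hx y hy hxy => hadj y hy x hx hxy.symm

theorem preconnected_induce_iff_forall_not_splits {G : SimpleGraph V} {A : Set V} :
    (G.induce A).Preconnected ↔ ∀ F, ¬ Splits G A F := by
  constructor
  · rintro h F ⟨hs, ⟨x, hx⟩, ⟨y, hy⟩, hadj⟩
    obtain ⟨p⟩ := h ⟨x, hs hx⟩ ⟨y, hy.1⟩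
    obtain ⟨d, -, h1, h2⟩ := p.exists_boundary_dart (Subtype.val ⁻¹' F) hx hy.2
    exact hadj _ h1 _ ⟨d.snd.2, h2⟩ d.adj
  · intro h x y
    by_contra hxy
    refine h {z | ∃ hz : z ∈ A, (G.induce A).Reachable x ⟨z, hz⟩}
      ⟨fun z hz => hz.1, ⟨x, x.2, .rfl⟩, ⟨y, y.2, fun hy => hxy hy.2⟩, ?_⟩
    rintro a ⟨ha, hxa⟩ b ⟨hb, hxb⟩ hab
    have hab' : (G.induce A).Adj ⟨a, ha⟩ ⟨b, hb⟩ := hab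
    exact hxb ⟨hb, hxa.trans hab'.reachable⟩

theorem ThreeConnected.not_splits {G : SimpleGraph V} (hG : ThreeConnected G) {S F : Set V}
    (hS : S.ncard ≤ 2) : ¬ Splits G Sᶜ F :=
  preconnected_induce_iff_forall_not_splits.1 (hG S hS).preconnected F

theorem ThreeConnected.not_splits_pair {G : SimpleGraph V} (hG : ThreeConnected G) (a b : V)
    {F : Set V} : ¬ Splits G ({a, b} : Set V)ᶜ F :=
  hG.not_splits ((Set.ncard_insert_le a {b}).trans (by simp))

theorem ThreeConnected.exists_adj_of_splits {G : SimpleGraph V} (hG : ThreeConnected G)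
    {a b c : V} {F : Set V} (hca : c ≠ a) (hcb : c ≠ b)
    (hF : Splits G ({a, b, c} : Set V)ᶜ F) : ∃ z ∈ F, G.Adj z c := by
  by_contra! hc
  obtain ⟨hs, hne, -, hadj⟩ := hF
  refine hG.not_splits_pair a b (F := F) ⟨fun x hx => ?_, hne, ⟨c, ?_⟩, ?_⟩
  · have := hs hx
    simp_all
  · have : c ∉ F := fun h => by simpa using hs h
    simp_all
  · intro x hx y hy hxy
    by_cases hyc : y = c
    · exact hc x hx (hyc ▸ hxy)
    · exact hadj x hx y (by simp_all) hxy

theorem ThreeConnected.adj_of_card_le {G : SimpleGraph V} [Finite V] (hG : ThreeConnected G)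
    (hV : Nat.card V ≤ 4) {x y : V} (hxy : x ≠ y) : G.Adj x y := by
  have hS : (({x, y} : Set V)ᶜ).ncard ≤ 2 := by
    have := Set.ncard_add_ncard_compl ({x, y} : Set V)
    rw [Set.ncard_pair hxy] at this
    omega
  by_contra hadj
  refine hG.not_splits hS (F := {x}) ⟨by simp, by simp, ⟨y, by simp [hxy.symm]⟩, ?_⟩
  rw [compl_compl]
  rintro a rfl b ⟨rfl | rfl, hb⟩
  · exact (hb rfl).elim
  · exact hadj

/-- The fibres of `φ` are the branch sets of a spanning `K_n` minor model in `G`. -/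
structure IsCompleteModel (G : SimpleGraph V) {n : ℕ} (φ : V → Fin n) : Prop where
  surj : Function.Surjective φ
  conn : ∀ i F, ¬ Splits G (φ ⁻¹' {i}) F
  adj : ∀ i j, i ≠ j → ∃ x y, φ x = i ∧ φ y = j ∧ G.Adj x y

/-- Across a small side `F` of a cut `{u, v, w}` with `u`, `v` in the same branch set, all of `F`
can be moved into the branch set of `w`. -/
theorem IsCompleteModel.exists_reassign {G : SimpleGraph V} (hG : ThreeConnected G) {n : ℕ}
    {φ : V → Fin n} (hφ : IsCompleteModel G φ) {u v w : V} {F : Set V} (hφuv : φ u = φ v)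
    (huv : G.Adj u v) (hwu : w ≠ u) (hwv : w ≠ v) (hF : Splits G ({u, v, w} : Set V)ᶜ F)
    (hsmall : ∀ i, ∃ z, φ z = i ∧ z ∉ F) :
    ∃ ψ : V → Fin n, IsCompleteModel G ψ ∧ ∀ z ∈ F, ψ z = ψ w := by
  classical
  have huF : u ∉ F := fun h => by simpa using hF.1 h
  have hvF : v ∉ F := fun h => by simpa using hF.1 h
  have hwF : w ∉ F := fun h => by simpa using hF.1 h
  have hnb : ∀ x ∈ F, ∀ y, y ∉ F → G.Adj x y → y = u ∨ y = v ∨ y = w := by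
    intro x hx y hy hxy
    by_contra hc
    exact hF.2.2.2 x hx y ⟨by simpa using hc, hy⟩ hxy
  have hcls : ∀ y ∈ F, φ y = φ u ∨ φ y = φ w := by
    intro y hy
    by_contra! hc
    obtain ⟨z, hz, hzF⟩ := hsmall (φ y)
    refine hφ.conn (φ y) (φ ⁻¹' {φ y} ∩ F) ⟨Set.inter_subset_left, ⟨y, rfl, hy⟩,
      ⟨z, hz, fun h => hzF h.2⟩, ?_⟩
    rintro a ⟨ha, haF⟩ b ⟨hb, hbF⟩ hab
    have hb' : φ b = φ y := hb
    rcases hnb a haF b (fun h => hbF ⟨hb, h⟩) hab with rfl | rfl | rfl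
    · exact hc.1 hb'.symm
    · exact hc.1 (hb'.symm.trans hφuv.symm)
    · exact hc.2 hb'.symm
  set ψ : V → Fin n := fun z => if z ∈ F then φ w else φ z
  have hψF : ∀ z ∈ F, ψ z = φ w := fun z hz => if_pos hz
  have hψn : ∀ z, z ∉ F → ψ z = φ z := fun z hz => if_neg hz
  have hψw : ∀ z, φ z = φ w → ψ z = φ w := fun z hz => by
    by_cases h : z ∈ F
    · exact hψF z h
    · rw [hψn z h, hz]
  refine ⟨ψ, ⟨?_, ?_, ?_⟩, fun z hz => by rw [hψF z hz, hψn w hwF]⟩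
  · intro i
    obtain ⟨z, rfl, hz⟩ := hsmall i
    exact ⟨z, hψn z hz⟩
  · intro i X hX
    by_cases hi : i = φ w
    · subst hi
      wlog hwX : w ∉ X generalizing X
      · exact this _ hX.compl fun h => h.2 (not_not.1 hwX)
      have hwA : w ∈ ψ ⁻¹' {φ w} \ X := ⟨hψn w hwF, hwX⟩
      by_cases hXF : (X ∩ F).Nonempty
      · refine hG.not_splits_pair u v (F := X ∩ F) ⟨?_, hXF, ⟨w, ?_, fun h => hwX h.1⟩, ?_⟩
        · rintro x ⟨-, hx⟩
          have := hF.1 hx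
          simp_all
        · simp [hwu, hwv]
        · rintro x ⟨hxX, hxF⟩ y ⟨hy, hyXF⟩ hxy
          have hyX : y ∉ X := by
            intro hyX
            have hyF : y ∉ F := fun h => hyXF ⟨hyX, h⟩
            rcases hnb x hxF y hyF hxy with rfl | rfl | rfl
            · simp at hy
            · simp at hy
            · exact hwX hyX
          refine hX.2.2.2 x hxX y ⟨?_, hyX⟩ hxy
          by_cases hyF : y ∈ F
          · exact hψF y hyF
          · rcases hnb x hxF y hyF hxy with rfl | rfl | rfl
            · simp at hy
            · simp at hy
            · exact hψn _ hwF
      · have hXnF : ∀ x ∈ X, x ∉ F := fun x hx hxF => hXF ⟨x, hx, hxF⟩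
        refine hφ.conn (φ w) X ⟨fun x hx => ?_, hX.2.1, ⟨w, rfl, hwX⟩, ?_⟩
        · have h : ψ x = φ w := hX.1 hx
          rwa [hψn x (hXnF x hx)] at h
        · exact fun x hx y hy => hX.2.2.2 x hx y ⟨hψw y hy.1, hy.2⟩
    · have hmem : ∀ z, ψ z = i → z ∉ F ∧ φ z = i := by
        intro z hz
        by_cases hzF : z ∈ F
        · exact (hi (hz.symm.trans (hψF z hzF))).elim
        · exact ⟨hzF, (hψn z hzF).symm.trans hz⟩
      wlog huX : u ∉ X generalizing X
      · exact this _ hX.compl fun h => h.2 (not_not.1 huX)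
      have hvX : v ∉ X := by
        intro hvX
        have h := (hmem v (hX.1 hvX)).2
        exact hX.2.2.2 v hvX u ⟨(hψn u huF).trans (hφuv.trans h), huX⟩ huv.symm
      obtain ⟨y₀, hy₀, hy₀X⟩ := hX.2.2.1
      refine hφ.conn i X ⟨fun x hx => (hmem x (hX.1 hx)).2, hX.2.1,
        ⟨y₀, (hmem y₀ hy₀).2, hy₀X⟩, ?_⟩
      intro x hx y hy hxy
      have hxi := hmem x (hX.1 hx)
      by_cases hyF : y ∈ F
      · rcases hnb y hyF x hxi.1 hxy.symm with rfl | rfl | rfl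
        · exact huX hx
        · exact hvX hx
        · exact hi hxi.2.symm
      · exact hX.2.2.2 x hx y ⟨(hψn y hyF).trans hy.1, hy.2⟩ hxy
  · have key : ∀ j, j ≠ φ w → ∃ x y, ψ x = φ w ∧ ψ y = j ∧ G.Adj x y := by
      intro j hj
      by_cases hju : j = φ u
      · have hF' : Splits G ({w, v, u} : Set V)ᶜ F := by
          rwa [show ({w, v, u} : Set V) = {u, v, w} by ext; simp; tauto]
        obtain ⟨z, hz, hzu⟩ := hG.exists_adj_of_splits hwu.symm huv.ne hF'
        exact ⟨z, u, hψF z hz, (hψn u huF).trans hju.symm, hzu⟩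
      · obtain ⟨x, y, hx, hy, hxy⟩ := hφ.adj (φ w) j hj.symm
        refine ⟨x, y, hψw x hx, (hψn y fun hyF => ?_).trans hy, hxy⟩
        rcases hcls y hyF with h | h
        · exact hju (hy.symm.trans h)
        · exact hj (hy.symm.trans h)
    have hout : ∀ x y, G.Adj x y → φ x ≠ φ y → φ x ≠ φ w → φ y ≠ φ w → x ∉ F := by
      intro x y hxy hne hx hy hxF
      have hxu := (hcls x hxF).resolve_right hx
      have hyF : y ∉ F := fun hyF => hne (hxu.trans ((hcls y hyF).resolve_right hy).symm)
      rcases hnb x hxF y hyF hxy with rfl | rfl | rfl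
      · exact hne hxu
      · exact hne (hxu.trans hφuv)
      · exact hy rfl
    intro i j hij
    by_cases hi : i = φ w
    · subst hi
      exact key j hij.symm
    by_cases hj : j = φ w
    · subst hj
      obtain ⟨x, y, hx, hy, hxy⟩ := key i hij
      exact ⟨y, x, hy, hx, hxy.symm⟩
    obtain ⟨x, y, rfl, rfl, hxy⟩ := hφ.adj i j hij
    exact ⟨x, y, hψn x (hout x y hxy hij hi hj), hψn y (hout y x hxy.symm hij.symm hj hi), hxy⟩

theorem exists_edge_without_three_cut_aux [Finite V] {G : SimpleGraph V} (hG : ThreeConnected G)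
    {n : ℕ} (k : ℕ) : ∀ (φ : V → Fin n), IsCompleteModel G φ → ∀ (u v w : V) (F : Set V),
    φ u = φ v → G.Adj u v → w ≠ u → w ≠ v → Splits G ({u, v, w} : Set V)ᶜ F →
    (∀ i, ∃ z, φ z = i ∧ z ∉ F) → F.ncard ≤ k →
    ∃ (ψ : V → Fin n) (a b : V), IsCompleteModel G ψ ∧ ψ a = ψ b ∧ G.Adj a b ∧
      ∀ c, c ≠ a → c ≠ b → ∀ D, ¬ Splits G ({a, b, c} : Set V)ᶜ D := by
  induction k with
  | zero =>
    intro φ _ u v w F _ _ _ _ hF _ hk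
    have := (Set.ncard_pos F.toFinite).2 hF.2.1
    omega
  | succ k ih =>
    intro φ hφ u v w F hφuv huv hwu hwv hF hsmall hk
    obtain ⟨ψ, hψ, hψF⟩ := hφ.exists_reassign hG hφuv huv hwu hwv hF hsmall
    obtain ⟨x, hxF, hxw⟩ := hG.exists_adj_of_splits hwu hwv hF
    by_cases hcut : ∀ c, c ≠ w → c ≠ x → ∀ D, ¬ Splits G ({w, x, c} : Set V)ᶜ D
    · exact ⟨ψ, w, x, hψ, (hψF x hxF).symm, hxw.symm, hcut⟩
    push Not at hcut
    obtain ⟨y, hyw, hyx, D₀, hD₀⟩ := hcut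
    obtain ⟨D, hD, huD, hvD⟩ : ∃ D, Splits G ({w, x, y} : Set V)ᶜ D ∧ u ∉ D ∧ v ∉ D := by
      by_cases h : u ∉ D₀ ∧ v ∉ D₀
      · exact ⟨D₀, hD₀, h⟩
      · refine ⟨_, hD₀.compl, fun hu => ?_, fun hv => ?_⟩
        · have hv : v ∈ D₀ := by
            by_contra hv
            exact h ⟨hu.2, hv⟩
          exact hD₀.2.2.2 v hv u hu huv.symm
        · have hu : u ∈ D₀ := by
            by_contra hu
            exact h ⟨hu, hv.2⟩
          exact hD₀.2.2.2 u hu v hv huv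
    have hDw : ∀ z ∈ D, z ≠ w ∧ z ≠ x ∧ z ≠ y := fun z hz => by simpa using hD.1 hz
    have hnb : ∀ p ∈ F, ∀ z ∈ D, G.Adj p z → z ∈ F := by
      intro p hp z hz hpz
      by_contra hzF
      refine hF.2.2.2 p hp z ⟨?_, hzF⟩ hpz
      have h1 : z ≠ u := fun h => huD (h ▸ hz)
      have h2 : z ≠ v := fun h => hvD (h ▸ hz)
      simp [h1, h2, (hDw z hz).1]
    obtain ⟨x', hx'D, hx'x⟩ := hG.exists_adj_of_splits (a := w) (b := y) (c := x) hxw.ne hyx.symm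
      (by rwa [show ({w, y, x} : Set V) = {w, x, y} by ext; simp; tauto])
    have hx'F := hnb x hxF x' hx'D hx'x.symm
    have hxD : x ∉ D := fun h => (hDw x h).2.1 rfl
    refine ih ψ hψ w x y (D ∩ F) (hψF x hxF).symm hxw.symm hyw hyx ?_ ?_ ?_
    · obtain ⟨r, hr, hrD⟩ := hD.2.2.1
      refine ⟨fun z hz => hD.1 hz.1, ⟨x', hx'D, hx'F⟩, ⟨r, hr, fun h => hrD h.1⟩, ?_⟩
      rintro p ⟨hpD, hpF⟩ z ⟨hz, hzDF⟩ hpz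
      by_cases hzD : z ∈ D
      · exact hzDF ⟨hzD, hnb p hpF z hzD hpz⟩
      · exact hD.2.2.2 p hpD z ⟨hz, hzD⟩ hpz
    · intro i
      by_cases hi : i = ψ w
      · exact ⟨w, hi.symm, fun h => (hDw w h.1).1 rfl⟩
      · obtain ⟨z, rfl⟩ := hψ.surj i
        exact ⟨z, rfl, fun h => hi (hψF z h.2)⟩
    · have : (D ∩ F).ncard < F.ncard :=
        Set.ncard_lt_ncard ⟨Set.inter_subset_right, fun h => hxD (h hxF).1⟩ F.toFinite
      omega

/-- A spanning complete minor model with fewer branch sets than vertices can be changed so that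
some edge inside a branch set lies in no 3-cut. -/
theorem exists_edge_without_three_cut [Finite V] {G : SimpleGraph V} (hG : ThreeConnected G)
    {n : ℕ} {φ : V → Fin n} (hφ : IsCompleteModel G φ) (hinj : ¬ Function.Injective φ) :
    ∃ (ψ : V → Fin n) (a b : V), IsCompleteModel G ψ ∧ ψ a = ψ b ∧ G.Adj a b ∧
      ∀ c, c ≠ a → c ≠ b → ∀ D, ¬ Splits G ({a, b, c} : Set V)ᶜ D := by
  obtain ⟨u, v, hφuv, huv⟩ : ∃ u v, φ u = φ v ∧ G.Adj u v := by
    obtain ⟨x, y, hxy, hne⟩ := Function.not_injective_iff.1 hinj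
    by_contra! hc
    refine hφ.conn (φ x) {x} ⟨by simp, by simp, ⟨y, hxy.symm, hne.symm⟩, ?_⟩
    rintro a rfl b ⟨hb, -⟩
    exact hc a b hb.symm
  by_cases hcut : ∀ c, c ≠ u → c ≠ v → ∀ D, ¬ Splits G ({u, v, c} : Set V)ᶜ D
  · exact ⟨φ, u, v, hφ, hφuv, huv, hcut⟩
  push Not at hcut
  obtain ⟨w, hwu, hwv, F, hF⟩ := hcut
  by_cases hsmall : ∀ i, ∃ z, φ z = i ∧ z ∉ F
  · exact exists_edge_without_three_cut_aux hG _ φ hφ u v w F hφuv huv hwu hwv hF hsmall le_rfl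
  refine exists_edge_without_three_cut_aux hG _ φ hφ u v w _ hφuv huv hwu hwv hF.compl ?_ le_rfl
  push Not at hsmall
  obtain ⟨i, hi⟩ := hsmall
  intro j
  by_cases hij : i = j
  · obtain ⟨z, rfl⟩ := hφ.surj i
    exact ⟨z, hij, fun h => h.2 (hi z rfl)⟩
  · obtain ⟨x, y, hx, hy, hxy⟩ := hφ.adj i j hij
    exact ⟨y, hy, fun h => hF.2.2.2 x (hi x hx) y h hxy⟩

/-- `H` is obtained from `G` by contracting the edge `uv`, with quotient map `π`. -/
structure IsContraction (G : SimpleGraph V) (H : SimpleGraph W) (π : V → W) (u v : V) : Prop where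
  surj : Function.Surjective π
  adj_uv : G.Adj u v
  map_eq : π u = π v
  eq_or : ∀ x y, π x = π y → x = y ∨ (x = u ∧ y = v) ∨ (x = v ∧ y = u)
  adj_iff : ∀ a b, H.Adj a b ↔ a ≠ b ∧ ∃ x y, π x = a ∧ π y = b ∧ G.Adj x y

theorem exists_isContraction {G : SimpleGraph V} {u v : V} (huv : G.Adj u v) :
    ∃ (H : SimpleGraph {z // z ≠ v}) (π : V → {z // z ≠ v}), IsContraction G H π u v := by
  classical
  let π : V → {z // z ≠ v} := fun z => if h : z = v then ⟨u, huv.ne⟩ else ⟨z, h⟩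
  have hv : π v = ⟨u, huv.ne⟩ := dif_pos rfl
  have hn : ∀ z (h : z ≠ v), π z = ⟨z, h⟩ := fun z h => dif_neg h
  refine ⟨⟨fun a b => a ≠ b ∧ ∃ x y, π x = a ∧ π y = b ∧ G.Adj x y, ?_, ⟨fun a h => h.1 rfl⟩⟩, π,
    ⟨fun a => ⟨a, hn a a.2⟩, huv, (hn u huv.ne).trans hv.symm, ?_, fun _ _ => Iff.rfl⟩⟩
  · refine ⟨?_⟩
    rintro a b ⟨hab, x, y, hx, hy, hxy⟩
    exact ⟨hab.symm, y, x, hy, hx, hxy.symm⟩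
  · intro x y hxy
    by_cases hx : x = v <;> by_cases hy : y = v
    · exact .inl (hx.trans hy.symm)
    · subst hx
      rw [hv, hn y hy, Subtype.mk.injEq] at hxy
      exact .inr (.inr ⟨rfl, hxy.symm⟩)
    · subst hy
      rw [hv, hn x hx, Subtype.mk.injEq] at hxy
      exact .inr (.inl ⟨hxy, rfl⟩)
    · rw [hn x hx, hn y hy, Subtype.mk.injEq] at hxy
      exact .inl hxy

namespace IsContraction

variable {G : SimpleGraph V} {H : SimpleGraph W} {π : V → W} {u v : V}

theorem symm (h : IsContraction G H π u v) : IsContraction G H π v u :=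
  ⟨h.surj, h.adj_uv.symm, h.map_eq.symm, fun x y hxy => (h.eq_or x y hxy).imp_right Or.symm,
    h.adj_iff⟩

theorem eq_of_map_eq (h : IsContraction G H π u v) {x y : V} (hxy : π x = π y) (hxu : x ≠ u)
    (hxv : x ≠ v) : x = y := by
  rcases h.eq_or x y hxy with h | h | h
  · exact h
  · exact (hxu h.1).elim
  · exact (hxv h.1).elim

theorem map_eq_iff (h : IsContraction G H π u v) {x : V} : π x = π u ↔ x = u ∨ x = v := by
  constructor
  · intro hx
    by_contra! hc
    exact hc.1 (h.eq_of_map_eq hx hc.1 hc.2)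
  · rintro (rfl | rfl)
    · rfl
    · exact h.map_eq.symm

theorem adj_map (h : IsContraction G H π u v) {x y : V} (hxy : G.Adj x y) (hne : π x ≠ π y) :
    H.Adj (π x) (π y) :=
  (h.adj_iff _ _).2 ⟨hne, x, y, rfl, rfl, hxy⟩

theorem adj_of_adj_map (h : IsContraction G H π u v) {x y : V} (hxy : H.Adj (π x) (π y))
    (hxu : x ≠ u) (hxv : x ≠ v) (hyu : y ≠ u) (hyv : y ≠ v) : G.Adj x y := by
  obtain ⟨-, a, b, ha, hb, hab⟩ := (h.adj_iff _ _).1 hxy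
  rwa [h.eq_of_map_eq ha.symm hxu hxv, h.eq_of_map_eq hb.symm hyu hyv]

theorem adj_or_of_adj_map (h : IsContraction G H π u v) {x : V} (hxy : H.Adj (π u) (π x)) :
    G.Adj u x ∨ G.Adj v x := by
  obtain ⟨hne, a, b, ha, hb, hab⟩ := (h.adj_iff _ _).1 hxy
  have hxu : x ≠ u := fun hx => hne (by rw [hx])
  have hxv : x ≠ v := fun hx => hne (by rw [hx, h.map_eq])
  rw [h.eq_of_map_eq hb.symm hxu hxv]
  rcases h.map_eq_iff.1 ha with rfl | rfl
  · exact .inl hab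
  · exact .inr hab

theorem not_splits_preimage (h : IsContraction G H π u v) {A : Set W}
    (hA : ∀ F, ¬ Splits H A F) (F : Set V) : ¬ Splits G (π ⁻¹' A) F := by
  rintro ⟨hs, ⟨x, hx⟩, ⟨y, hyA, hyF⟩, hadj⟩
  have hsat : ∀ a ∈ F, ∀ b, π b = π a → b ∈ F := by
    intro a ha b hab
    by_contra hb
    have hbA : b ∈ π ⁻¹' A := by
      rw [Set.mem_preimage, hab]
      exact hs ha
    rcases h.eq_or b a hab with rfl | ⟨rfl, rfl⟩ | ⟨rfl, rfl⟩
    · exact hb ha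
    · exact hadj _ ha _ ⟨hbA, hb⟩ h.adj_uv.symm
    · exact hadj _ ha _ ⟨hbA, hb⟩ h.adj_uv
  refine hA (π '' F) ⟨Set.image_subset_iff.2 hs, ⟨_, x, hx, rfl⟩,
    ⟨π y, hyA, fun ⟨a, ha, hay⟩ => hyF (hsat a ha y hay.symm)⟩, ?_⟩
  rintro _ ⟨a, ha, rfl⟩ b ⟨hb, hbF⟩ hab
  obtain ⟨-, a', b', ha', rfl, hab'⟩ := (h.adj_iff _ _).1 hab
  exact hadj a' (hsat a ha a' ha') b' ⟨hb, fun hb' => hbF ⟨b', hb', rfl⟩⟩ hab'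

theorem splits_preimage (h : IsContraction G H π u v) {A F : Set W} (hF : Splits H A F) :
    Splits G (π ⁻¹' A) (π ⁻¹' F) := by
  obtain ⟨hs, hne, hne', hadj⟩ := hF
  refine ⟨Set.preimage_mono hs, hne.preimage h.surj, hne'.preimage h.surj, ?_⟩
  intro x hx y hy hxy
  refine hadj (π x) hx (π y) hy (h.adj_map hxy fun he => hy.2 ?_)
  rwa [Set.mem_preimage, ← he]

theorem card_eq [Finite V] (h : IsContraction G H π u v) : Nat.card V = Nat.card W + 1 := by
  have hW : Finite W := Finite.of_surjective π h.surj
  have hbij : Function.Bijective fun z : {z : V // z ≠ v} => π z := by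
    constructor
    · rintro ⟨x, hx⟩ ⟨y, hy⟩ hxy
      rcases h.eq_or x y hxy with h | h | h
      · exact Subtype.ext h
      · exact (hy h.2).elim
      · exact (hx h.1).elim
    · intro a
      obtain ⟨x, rfl⟩ := h.surj a
      by_cases hx : x = v
      · exact ⟨⟨u, h.adj_uv.ne⟩, by rw [hx]; exact h.map_eq⟩
      · exact ⟨⟨x, hx⟩, rfl⟩
  have h1 := Nat.card_eq_of_bijective _ hbij
  have h2 := Set.ncard_add_ncard_compl ({v} : Set V)
  rw [Set.ncard_singleton] at h2
  have h3 : Nat.card {z : V // z ≠ v} = (({v} : Set V)ᶜ).ncard := rfl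
  omega

theorem threeConnected [Finite V] (h : IsContraction G H π u v) (hG : ThreeConnected G)
    (hV : 4 ≤ Nat.card V)
    (hcut : ∀ w, w ≠ u → w ≠ v → ∀ F, ¬ Splits G ({u, v, w} : Set V)ᶜ F) :
    ThreeConnected H := by
  have hW : Finite W := Finite.of_surjective π h.surj
  have hcard := h.card_eq
  intro T hT
  have hne : (Tᶜ).Nonempty := by
    rw [Set.nonempty_iff_ne_empty]
    intro he
    have := Set.ncard_add_ncard_compl T
    rw [he, Set.ncard_empty] at this
    omega
  have := hne.to_subtype
  refine ⟨preconnected_induce_iff_forall_not_splits.2 fun F hF => ?_⟩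
  have hF' := h.splits_preimage hF
  rw [Set.preimage_compl] at hF'
  by_cases hu : π u ∈ T
  · have hT1 : (T \ {π u}).ncard ≤ 1 := by
      have := Set.ncard_sdiff_singleton_add_one hu
      omega
    obtain hemp | ⟨q, hq⟩ := (T \ {π u}).eq_empty_or_nonempty
    · refine hG.not_splits_pair u v (F := π ⁻¹' F) ?_
      convert hF' using 2
      ext x
      rw [Set.mem_preimage, Set.mem_insert_iff, Set.mem_singleton_iff, ← h.map_eq_iff]
      constructor
      · intro hx
        rwa [hx]
      · intro hx
        by_contra hc
        exact (hemp ▸ (⟨hx, hc⟩ : π x ∈ T \ {π u}) : π x ∈ (∅ : Set W))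
    · obtain ⟨w, rfl⟩ := h.surj q
      have hwuv : ¬ (w = u ∨ w = v) := fun hw => hq.2 (h.map_eq_iff.2 hw)
      push Not at hwuv
      refine hcut w hwuv.1 hwuv.2 (π ⁻¹' F) ?_
      convert hF' using 2
      ext x
      rw [Set.mem_preimage, Set.mem_insert_iff, Set.mem_insert_iff, Set.mem_singleton_iff,
        ← or_assoc, ← h.map_eq_iff]
      constructor
      · rintro (hx | rfl)
        · rwa [hx]
        · exact hq.1
      · intro hx
        by_contra! hc
        have := (Set.ncard_le_one (Set.toFinite _)).1 hT1 (π x) ⟨hx, hc.1⟩ (π w) hq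
        exact hc.2 (h.eq_of_map_eq this.symm hwuv.1 hwuv.2).symm
  · refine hG.not_splits ?_ hF'
    refine le_trans (Set.ncard_le_ncard_of_injOn π (fun x hx => hx) ?_ T.toFinite) hT
    intro x hx y _ hxy
    have hxuv : ¬ (x = u ∨ x = v) := fun hx' => hu (h.map_eq_iff.2 hx' ▸ hx)
    push Not at hxuv
    exact h.eq_of_map_eq hxy hxuv.1 hxuv.2

theorem exists_isCompleteModel (h : IsContraction G H π u v) {n : ℕ} {φ : V → Fin n}
    (hφ : IsCompleteModel G φ) (huv : φ u = φ v) :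
    ∃ ψ : W → Fin n, IsCompleteModel H ψ := by
  have hφπ : ∀ x y, π x = π y → φ x = φ y := by
    intro x y hxy
    rcases h.eq_or x y hxy with rfl | ⟨rfl, rfl⟩ | ⟨rfl, rfl⟩
    · rfl
    · exact huv
    · exact huv.symm
  have hψ : ∀ x, φ (Function.surjInv h.surj (π x)) = φ x := fun x =>
    hφπ _ _ (Function.surjInv_eq h.surj (π x))
  refine ⟨fun a => φ (Function.surjInv h.surj a), ⟨fun i => ?_, fun i F hF => ?_,
    fun i j hij => ?_⟩⟩
  · obtain ⟨x, rfl⟩ := hφ.surj i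
    exact ⟨π x, hψ x⟩
  · refine hφ.conn i (π ⁻¹' F) ?_
    convert h.splits_preimage hF using 1
    ext x
    simp [hψ]
  · obtain ⟨x, y, rfl, rfl, hxy⟩ := hφ.adj i j hij
    exact ⟨π x, π y, hψ x, hψ y, h.adj_map hxy fun he => hij (hφπ x y he)⟩

/-- Contracting an edge destroys that edge and one edge for each common neighbour. -/
theorem ncard_edgeSet_le [Finite V] (h : IsContraction G H π u v) :
    G.edgeSet.ncard ≤ H.edgeSet.ncard + 1 + {x | G.Adj u x ∧ G.Adj v x}.ncard := by
  have hW : Finite W := Finite.of_surjective π h.surj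
  set R : Set (Sym2 V) := {s(u, v)} ∪ (fun x => s(v, x)) '' {x | G.Adj u x ∧ G.Adj v x}
  have hRc : R.ncard ≤ 1 + {x | G.Adj u x ∧ G.Adj v x}.ncard := by
    refine (Set.ncard_union_le _ _).trans ?_
    rw [Set.ncard_singleton]
    exact Nat.add_le_add_left (Set.ncard_image_le (Set.toFinite _)) 1
  have hle : (G.edgeSet \ R).ncard ≤ H.edgeSet.ncard := by
    refine Set.ncard_le_ncard_of_injOn (Sym2.map π) ?_ ?_ (Set.toFinite _)
    · intro e
      induction e with | _ x y
      rintro ⟨hxy, hn⟩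
      refine h.adj_map hxy fun he => hn (.inl ?_)
      rcases h.eq_or x y he with rfl | ⟨rfl, rfl⟩ | ⟨rfl, rfl⟩
      · exact (G.irrefl hxy).elim
      · rfl
      · exact Sym2.eq_swap
    · have key : ∀ x y z w, G.Adj x y → s(x, y) ∉ R → G.Adj z w → s(z, w) ∉ R → π x = π z →
          π y = π w → s(x, y) = s(z, w) := by
        have hend : ∀ x y z, G.Adj x y → s(x, y) ∉ R → G.Adj z y → s(z, y) ∉ R → π x = π z →
            x = z := by
          intro x y z hxy hxyR hzy hzyR hxz
          rcases h.eq_or x z hxz with rfl | ⟨rfl, rfl⟩ | ⟨rfl, rfl⟩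
          · rfl
          · exact (hzyR (.inr ⟨y, ⟨hxy, hzy⟩, rfl⟩)).elim
          · exact (hxyR (.inr ⟨y, ⟨hzy, hxy⟩, rfl⟩)).elim
        have hedge : ∀ x y, G.Adj x y → s(x, y) ∉ R → ¬ ((x = u ∨ x = v) ∧ (y = u ∨ y = v)) := by
          rintro x y hxy hxyR ⟨rfl | rfl, rfl | rfl⟩
          · exact G.irrefl hxy
          · exact hxyR (.inl rfl)
          · exact hxyR (.inl Sym2.eq_swap)
          · exact G.irrefl hxy
        intro x y z w hxy hxyR hzw hzwR hxz hyw
        have hxy' := hedge x y hxy hxyR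
        by_cases hx : x = u ∨ x = v
        · have hy : ¬ (y = u ∨ y = v) := fun hy => hxy' ⟨hx, hy⟩
          push Not at hy
          obtain rfl := h.eq_of_map_eq hyw hy.1 hy.2
          rw [hend x y z hxy hxyR hzw hzwR hxz]
        · push Not at hx
          obtain rfl := h.eq_of_map_eq hxz hx.1 hx.2
          rw [hend y x w hxy.symm (by rwa [Sym2.eq_swap]) hzw.symm (by rwa [Sym2.eq_swap]) hyw]
      intro e he f hf hef
      induction e with | _ x y
      induction f with | _ z w
      rw [Sym2.map_mk, Sym2.map_mk] at hef
      rcases Sym2.eq_iff.1 hef with ⟨h1, h2⟩ | ⟨h1, h2⟩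
      · exact key x y z w he.1 he.2 hf.1 hf.2 h1 h2
      · rw [Sym2.eq_swap (a := z)]
        exact key x y w z he.1 he.2 hf.1.symm (by rw [Sym2.eq_swap]; exact hf.2) h1 h2
  have := Set.ncard_le_ncard_sdiff_add_ncard G.edgeSet R (Set.toFinite _)
  omega

end IsContraction

theorem ncard_neighborSet_induce (G : SimpleGraph V) (C : Set V) (x : C) :
    ((G.induce C).neighborSet x).ncard = {y | y ∈ C ∧ G.Adj x y}.ncard := by
  rw [← Set.ncard_image_of_injective _ Subtype.val_injective]
  congr 1
  ext y
  constructor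
  · rintro ⟨z, hz, rfl⟩
    exact ⟨z.2, hz⟩
  · rintro ⟨hy, hxy⟩
    exact ⟨⟨y, hy⟩, hxy, rfl⟩

theorem IsInducedCycle.of_iso {G : SimpleGraph V} {H : SimpleGraph W} {D : Set V} {C : Set W}
    (e : G.induce D ≃g H.induce C) (hC : IsInducedCycle H C) : IsInducedCycle G D := by
  refine ⟨?_, e.connected_iff.2 hC.2.1, fun x => ?_⟩
  · rw [show D.ncard = C.ncard from Nat.card_congr e.toEquiv]
    exact hC.1
  · rw [← hC.2.2 (e x)]
    exact Nat.card_congr (e.mapNeighborSet x)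

theorem IsInducedCycle.of_bijOn {G : SimpleGraph V} {H : SimpleGraph W} {D : Set V} {C : Set W}
    {π : V → W} (hπ : Set.BijOn π D C)
    (hadj : ∀ x ∈ D, ∀ y ∈ D, H.Adj (π x) (π y) ↔ G.Adj x y) (hC : IsInducedCycle H C) :
    IsInducedCycle G D :=
  .of_iso ⟨hπ.equiv, fun {x y} => hadj x x.2 y y.2⟩ hC

theorem isInducedCycle_of_isClique {G : SimpleGraph V} {D : Set V} (hD : G.IsClique D)
    (h3 : D.ncard = 3) : IsInducedCycle G D := by
  have hne : D.Nonempty := Set.nonempty_of_ncard_ne_zero (by omega)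
  have := hne.to_subtype
  refine ⟨h3.ge, ⟨preconnected_induce_iff_forall_not_splits.2 ?_⟩, fun x => ?_⟩
  · rintro F ⟨hs, ⟨x, hx⟩, ⟨y, hy⟩, hadj⟩
    exact hadj x hx y hy (hD (hs hx) hy.1 fun h => hy.2 (h ▸ hx))
  · have : {y | y ∈ D ∧ G.Adj x y} = D \ {x.1} := by
      ext y
      exact ⟨fun h => ⟨h.1, h.2.ne'⟩, fun h => ⟨h.1, hD x.2 h.1 (Ne.symm h.2)⟩⟩
    rw [ncard_neighborSet_induce, this]
    have := Set.ncard_sdiff_singleton_add_one x.2 (Set.finite_of_ncard_ne_zero (by omega))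
    omega

namespace IsContraction

variable {G : SimpleGraph V} {H : SimpleGraph W} {π : V → W} {u v : V}

theorem preconnected_preimage (h : IsContraction G H π u v) {A : Set W}
    (hA : (H.induce A).Preconnected) : (G.induce (π ⁻¹' A)).Preconnected :=
  preconnected_induce_iff_forall_not_splits.2
    (h.not_splits_preimage (preconnected_induce_iff_forall_not_splits.1 hA))

theorem isNonsepCycle_preimage (h : IsContraction G H π u v) {C : Set W}
    (hC : IsNonsepCycle H C) (hu : π u ∉ C) : IsNonsepCycle G (π ⁻¹' C) := by
  have hne : ∀ x, π x ∈ C → x ≠ u ∧ x ≠ v := by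
    intro x hx
    constructor
    · rintro rfl
      exact hu hx
    · rintro rfl
      exact hu (h.map_eq ▸ hx)
  refine ⟨hC.1.of_bijOn (π := π) ⟨fun x hx => hx, fun x hx y hy hxy =>
    h.eq_of_map_eq hxy (hne x hx).1 (hne x hx).2, fun a ha => ?_⟩ fun x hx y hy =>
      ⟨fun hxy => h.adj_of_adj_map hxy (hne x hx).1 (hne x hx).2 (hne y hy).1 (hne y hy).2,
        fun hxy => h.adj_map hxy fun he =>
          hxy.ne (h.eq_of_map_eq he (hne x hx).1 (hne x hx).2)⟩, ?_⟩
  · obtain ⟨x, rfl⟩ := h.surj a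
    exact ⟨x, ha, rfl⟩
  · rw [← Set.preimage_compl]
    exact h.preconnected_preimage hC.2

/-- A cycle through the contracted vertex lifts to a cycle through `u` only, if `u` sees both
cycle neighbours of the contracted vertex and `v` has a neighbour off the cycle. -/
theorem isNonsepCycle_preimage_sdiff (h : IsContraction G H π u v) {C : Set W}
    (hC : IsNonsepCycle H C) (hu : π u ∈ C)
    (hadj : ∀ x, π x ∈ C → H.Adj (π u) (π x) → G.Adj u x)
    (hout : ∃ z, π z ∉ C ∧ G.Adj v z) :
    IsNonsepCycle G (π ⁻¹' C \ {v}) ∧ π '' (π ⁻¹' C \ {v}) = C := by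
  have hinj : Set.InjOn π (π ⁻¹' C \ {v}) := by
    rintro x ⟨-, hx⟩ y ⟨-, hy⟩ hxy
    rcases h.eq_or x y hxy with h | h | h
    · exact h
    · exact (hy h.2).elim
    · exact (hx h.1).elim
  have hbij : Set.BijOn π (π ⁻¹' C \ {v}) C := by
    refine ⟨fun x hx => hx.1, hinj, fun a ha => ?_⟩
    obtain ⟨x, rfl⟩ := h.surj a
    by_cases hx : x = v
    · exact ⟨u, ⟨hu, h.adj_uv.ne⟩, hx ▸ h.map_eq⟩
    · exact ⟨x, ⟨ha, hx⟩, rfl⟩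
  refine ⟨⟨hC.1.of_bijOn hbij fun x hx y hy => ⟨fun hxy => ?_, fun hxy => ?_⟩, ?_⟩, hbij.image_eq⟩
  · by_cases hxu : x = u
    · subst hxu
      exact hadj y hy.1 hxy
    by_cases hyu : y = u
    · subst hyu
      exact (hadj x hx.1 hxy.symm).symm
    exact h.adj_of_adj_map hxy hxu hx.2 hyu hy.2
  · exact h.adj_map hxy fun he => hxy.ne (hinj hx hy he)
  · refine preconnected_induce_iff_forall_not_splits.2 fun X hX => ?_
    wlog hvX : v ∉ X generalizing X
    · exact this _ hX.compl fun h => h.2 (not_not.1 hvX)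
    obtain ⟨z, hzC, hvz⟩ := hout
    have hv : v ∈ (π ⁻¹' C \ {v})ᶜ \ X := ⟨fun h => h.2 rfl, hvX⟩
    have hzX : z ∉ X := fun hzX => hX.2.2.2 z hzX v hv hvz.symm
    refine preconnected_induce_iff_forall_not_splits.1 (h.preconnected_preimage hC.2) X
      ⟨fun x hx hxC => hX.1 hx ⟨hxC, fun hxv => hvX (hxv ▸ hx)⟩, hX.2.1, ⟨z, hzC, hzX⟩, ?_⟩
    exact fun x hx y hy => hX.2.2.2 x hx y ⟨fun hy' => hy.1 hy'.1, hy.2⟩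

theorem neighbors_eq_pair (h : IsContraction G H π u v) {C : Set W} (hu : π u ∈ C) {a b : V}
    (hab : {y | y ∈ C ∧ H.Adj (π u) y} = {π a, π b}) (hua : G.Adj u a) (hub : ¬ G.Adj u b)
    (hbu : b ≠ u) (hbv : b ≠ v) (hau : a ≠ u) (hav : a ≠ v) :
    {y | y ∈ π ⁻¹' C ∧ G.Adj u y} = {v, a} := by
  have haC : π a ∈ {y | y ∈ C ∧ H.Adj (π u) y} := by
    rw [hab]
    exact .inl rfl
  ext y
  constructor
  · rintro ⟨hy, huy⟩
    by_cases hyv : y = v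
    · exact .inl hyv
    have hne : π u ≠ π y := fun he => by
      rcases h.map_eq_iff.1 he.symm with rfl | rfl
      · exact huy.ne rfl
      · exact hyv rfl
    have hyC : π y ∈ {y | y ∈ C ∧ H.Adj (π u) y} := ⟨hy, h.adj_map huy hne⟩
    rw [hab] at hyC
    rcases hyC with hya | hyb
    · exact .inr (h.eq_of_map_eq hya.symm hau hav).symm
    · rw [h.eq_of_map_eq (Eq.symm hyb) hbu hbv] at hub
      exact (hub huy).elim
  · rintro (rfl | rfl)
    · exact ⟨by rwa [Set.mem_preimage, ← h.map_eq], h.adj_uv⟩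
    · exact ⟨haC.1, hua⟩

/-- A cycle through the contracted vertex lifts to a cycle through the edge `uv`, if each of its
ends sees exactly one of the cycle neighbours of the contracted vertex. -/
theorem isNonsepCycle_preimage_of_adj (h : IsContraction G H π u v) {C : Set W}
    (hC : IsNonsepCycle H C) (hu : π u ∈ C) {a b : V}
    (hab : {y | y ∈ C ∧ H.Adj (π u) y} = {π a, π b}) (hua : G.Adj u a) (hub : ¬ G.Adj u b)
    (hva : ¬ G.Adj v a) (hvb : G.Adj v b) : IsNonsepCycle G (π ⁻¹' C) := by
  have hfinC : C.Finite := Set.finite_of_ncard_ne_zero (by have := hC.1.1; omega)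
  have hfin : (π ⁻¹' C).Finite := by
    have : (π ⁻¹' C) ⊆ {v} ∪ (π ⁻¹' C \ {v}) := by
      intro x hx
      by_cases hxv : x = v
      · exact .inl hxv
      · exact .inr ⟨hx, hxv⟩
    refine Set.Finite.subset ((Set.finite_singleton v).union (.of_finite_image
      (hfinC.subset (Set.image_subset_iff.2 Set.sdiff_subset)) ?_)) this
    rintro x ⟨-, hx⟩ y ⟨-, hy⟩ hxy
    rcases h.eq_or x y hxy with h | h | h
    · exact h
    · exact (hy h.2).elim
    · exact (hx h.1).elim
  have hne : ∀ x, π x ∈ ({π a, π b} : Set W) → x ≠ u ∧ x ≠ v := by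
    intro x hx
    rw [← hab] at hx
    constructor
    · rintro rfl
      exact H.irrefl hx.2
    · rintro rfl
      exact H.irrefl (h.map_eq ▸ hx.2)
  obtain ⟨hau, hav⟩ := hne a (.inl rfl)
  obtain ⟨hbu, hbv⟩ := hne b (.inr rfl)
  have himg : π '' (π ⁻¹' C) = C := Set.image_preimage_eq C h.surj
  have hcon := h.preconnected_preimage hC.1.2.1.preconnected
  have hnon : Nonempty (π ⁻¹' C) := ⟨⟨u, hu⟩⟩
  refine ⟨⟨?_, ⟨hcon⟩, ?_⟩, ?_⟩
  · calc 3 ≤ C.ncard := hC.1.1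
      _ = (π '' (π ⁻¹' C)).ncard := by rw [himg]
      _ ≤ _ := Set.ncard_image_le hfin
  · rintro ⟨x, hx⟩
    rw [ncard_neighborSet_induce]
    by_cases hxu : x = u
    · subst hxu
      rw [h.neighbors_eq_pair hu hab hua hub hbu hbv hau hav, Set.ncard_pair hav.symm]
    by_cases hxv : x = v
    · subst hxv
      have hx' : π x ∈ C := hx
      rw [h.symm.neighbors_eq_pair hx' (by rw [← h.map_eq, hab, Set.pair_comm]) hvb hva hav hau
        hbv hbu, Set.ncard_pair hbu.symm]
    have hdeg := hC.1.2.2 ⟨π x, hx⟩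
    rw [ncard_neighborSet_induce] at hdeg
    rw [← hdeg, ← Set.InjOn.ncard_image (f := π)]
    · congr 1
      ext c
      constructor
      · rintro ⟨y, ⟨hy, hxy⟩, rfl⟩
        exact ⟨hy, h.adj_map hxy fun he => hxy.ne (h.eq_of_map_eq he hxu hxv)⟩
      · rintro ⟨hc, hxc⟩
        obtain ⟨-, x', y, hx', rfl, hxy⟩ := (h.adj_iff _ _).1 hxc
        rw [← h.eq_of_map_eq hx'.symm hxu hxv] at hxy
        exact ⟨y, ⟨hc, hxy⟩, rfl⟩
    · have hboth : ¬ (G.Adj x u ∧ G.Adj x v) := by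
        rintro ⟨h1, h2⟩
        have hx' : π x ∈ {y | y ∈ C ∧ H.Adj (π u) y} := ⟨hx, h.adj_map h1.symm fun he => by
          rcases h.map_eq_iff.1 he.symm with he | he
          · exact hxu he
          · exact hxv he⟩
        rw [hab] at hx'
        rcases hx' with he | he
        · exact hva (h.eq_of_map_eq he hxu hxv ▸ h2.symm)
        · exact hub (h.eq_of_map_eq he hxu hxv ▸ h1.symm)
      rintro y ⟨-, hxy⟩ z ⟨-, hxz⟩ hyz
      rcases h.eq_or y z hyz with rfl | ⟨rfl, rfl⟩ | ⟨rfl, rfl⟩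
      · rfl
      · exact (hboth ⟨hxy, hxz⟩).elim
      · exact (hboth ⟨hxz, hxy⟩).elim
  · rw [← Set.preimage_compl]
    exact h.preconnected_preimage hC.2

/-- If `u` sees both cycle neighbours of the contracted vertex, the cycle lifts. -/
theorem exists_lift_of_adj [Finite V] (h : IsContraction G H π u v) (hG : ThreeConnected G)
    (hV : 5 ≤ Nat.card V) {C : Set W} (hC : IsNonsepCycle H C) (hu : π u ∈ C) {a b : V}
    (hab : {y | y ∈ C ∧ H.Adj (π u) y} = {π a, π b}) (hau : G.Adj u a) (hbu : G.Adj u b)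
    (hav : a ≠ v) (hbv : b ≠ v) : ∃ D, IsNonsepCycle G D ∧ π '' D = C := by
  have hsub : ∀ y, π y ∈ C → π y ≠ π u → (G.Adj u y ∨ G.Adj v y) → y = a ∨ y = b := by
    intro y hy hyu hadj
    have hy' : π y ∈ {y | y ∈ C ∧ H.Adj (π u) y} := by
      refine ⟨hy, ?_⟩
      rcases hadj with hadj | hadj
      · exact h.adj_map hadj hyu.symm
      · rw [h.map_eq]
        exact h.adj_map hadj (h.map_eq ▸ hyu.symm)
    rw [hab] at hy'
    have hy'' : ¬ (y = u ∨ y = v) := fun hc => hyu (h.map_eq_iff.2 hc)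
    push Not at hy''
    exact hy'.imp (fun he => h.eq_of_map_eq he hy''.1 hy''.2)
      fun he => h.eq_of_map_eq he hy''.1 hy''.2
  have hpair : ∀ x, H.Adj (π u) (π x) → π x ∈ C → x = a ∨ x = b := by
    intro x hx hxC
    exact hsub x hxC hx.ne' (h.adj_or_of_adj_map hx)
  by_cases hv : ∃ z, π z ∉ C ∧ G.Adj v z
  · refine ⟨_, h.isNonsepCycle_preimage_sdiff hC hu (fun x hx hux => ?_) hv⟩
    rcases hpair x hux hx with rfl | rfl
    · exact hau
    · exact hbu
  push Not at hv
  have hNv : ∀ y, G.Adj v y → y = u ∨ y = a ∨ y = b := by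
    intro y hy
    by_contra! hc
    have hyC : π y ∈ C := by
      by_contra hyC
      exact hv y hyC hy
    refine (hsub y hyC (fun he => ?_) (.inr hy)).elim hc.2.1 hc.2.2
    rcases h.map_eq_iff.1 he with rfl | rfl
    · exact hc.1 rfl
    · exact G.irrefl hy
  have hbig : ∀ T : Set V, T.ncard ≤ 4 → (Tᶜ).Nonempty := by
    intro T hT
    rw [Set.nonempty_iff_ne_empty]
    intro he
    have := Set.ncard_add_ncard_compl T
    rw [he, Set.ncard_empty] at this
    omega
  obtain ⟨q, hq⟩ := hbig {u, v, a, b} ((Set.ncard_insert_le _ _).trans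
    (by have := Set.ncard_insert_le v {a, b}; have := Set.ncard_insert_le a {b}
        rw [Set.ncard_singleton] at this; omega))
  have hq' : q ≠ u ∧ q ≠ v ∧ q ≠ a ∧ q ≠ b := by simpa using hq
  have huv := h.adj_uv
  have hva : G.Adj v a := by
    by_contra hva
    refine hG.not_splits_pair u b (F := {v}) ⟨by simp [huv.ne', hbv.symm], by simp,
      ⟨q, by simp [hq']⟩, ?_⟩
    rintro x rfl y ⟨hy, -⟩ hxy
    rcases hNv y hxy with rfl | rfl | rfl
    · simp at hy
    · exact hva hxy
    · simp at hy
  have hvb : G.Adj v b := by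
    by_contra hvb
    refine hG.not_splits_pair u a (F := {v}) ⟨by simp [huv.ne', hav.symm], by simp,
      ⟨q, by simp [hq']⟩, ?_⟩
    rintro x rfl y ⟨hy, -⟩ hxy
    rcases hNv y hxy with rfl | rfl | rfl
    · simp at hy
    · simp at hy
    · exact hvb hxy
  refine ⟨_, h.symm.isNonsepCycle_preimage_sdiff hC (h.map_eq ▸ hu) (fun x hx hux => ?_) ?_⟩
  · rcases hpair x (h.map_eq ▸ hux) hx with rfl | rfl
    · exact hva
    · exact hvb
  by_contra! hu'
  refine hG.not_splits_pair a b (F := {u, v}) ⟨?_, by simp, ⟨q, by simp [hq']⟩, ?_⟩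
  · rintro x (rfl | rfl)
    · simp [hau.ne, hbu.ne]
    · simp [hav.symm, hbv.symm]
  · rintro x hx y ⟨hy, hyuv⟩ hxy
    simp only [Set.mem_compl_iff, Set.mem_insert_iff, Set.mem_singleton_iff, not_or] at hy hyuv
    rcases hx with rfl | rfl
    · have hyC : π y ∈ C := by
        by_contra hyC
        exact hu' y hyC hxy
      exact (hsub y hyC (fun he => (h.map_eq_iff.1 he).elim hyuv.1 hyuv.2) (.inl hxy)).elim
        hy.1 hy.2
    · rcases hNv y hxy with h | h | h
      · exact hyuv.1 h
      · exact hy.1 h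
      · exact hy.2 h

theorem exists_lift [Finite V] (h : IsContraction G H π u v) (hG : ThreeConnected G)
    (hV : 5 ≤ Nat.card V) {C : Set W} (hC : IsNonsepCycle H C) :
    ∃ D, IsNonsepCycle G D ∧ π '' D = C := by
  have himg : π '' (π ⁻¹' C) = C := Set.image_preimage_eq C h.surj
  by_cases hu : π u ∈ C
  swap
  · exact ⟨_, h.isNonsepCycle_preimage hC hu, himg⟩
  have hdeg := hC.1.2.2 ⟨π u, hu⟩
  rw [ncard_neighborSet_induce] at hdeg
  obtain ⟨a', b', -, hab⟩ := Set.ncard_eq_two.1 hdeg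
  obtain ⟨a, rfl⟩ := h.surj a'
  obtain ⟨b, rfl⟩ := h.surj b'
  change {y | y ∈ C ∧ H.Adj (π u) y} = {π a, π b} at hab
  have ha : π a ∈ {y | y ∈ C ∧ H.Adj (π u) y} := by
    rw [hab]
    exact .inl rfl
  have hb : π b ∈ {y | y ∈ C ∧ H.Adj (π u) y} := by
    rw [hab]
    exact .inr rfl
  have hne : ∀ x, H.Adj (π u) (π x) → x ≠ u ∧ x ≠ v := by
    intro x hx
    constructor
    · rintro rfl
      exact H.irrefl hx
    · rintro rfl
      exact H.irrefl (h.map_eq ▸ hx)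
  have hv : π v ∈ C := h.map_eq ▸ hu
  have hab' : {y | y ∈ C ∧ H.Adj (π v) y} = {π a, π b} := h.map_eq ▸ hab
  by_cases h1 : G.Adj u a ∧ G.Adj u b
  · exact h.exists_lift_of_adj hG hV hC hu hab h1.1 h1.2 (hne a ha.2).2 (hne b hb.2).2
  by_cases h2 : G.Adj v a ∧ G.Adj v b
  · exact h.symm.exists_lift_of_adj hG hV hC hv hab' h2.1 h2.2 (hne a ha.2).1 (hne b hb.2).1
  refine ⟨_, ?_, himg⟩
  rcases h.adj_or_of_adj_map ha.2 with hua | hva <;> rcases h.adj_or_of_adj_map hb.2 with hub | hvb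
  · exact (h1 ⟨hua, hub⟩).elim
  · exact h.isNonsepCycle_preimage_of_adj hC hu hab hua (fun h => h1 ⟨hua, h⟩)
      (fun h => h2 ⟨h, hvb⟩) hvb
  · exact h.symm.isNonsepCycle_preimage_of_adj hC hv hab' hva (fun h => h2 ⟨hva, h⟩)
      (fun h => h1 ⟨h, hub⟩) hub
  · exact (h2 ⟨hva, hvb⟩).elim

theorem isNonsepCycle_triangle (h : IsContraction G H π u v) (hH : ThreeConnected H) {x : V}
    (hux : G.Adj u x) (hvx : G.Adj v x) : IsNonsepCycle G {u, v, x} := by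
  refine ⟨isInducedCycle_of_isClique ?_ ?_, ?_⟩
  · simp [SimpleGraph.isClique_iff, Set.pairwise_insert, h.adj_uv, h.adj_uv.symm, hux, hvx,
      hux.symm, hvx.symm]
  · rw [Set.ncard_eq_three]
    exact ⟨u, v, x, h.adj_uv.ne, hux.ne, hvx.ne, rfl⟩
  · have hS : ({π u, π x} : Set W).ncard ≤ 2 := (Set.ncard_insert_le _ _).trans (by simp)
    have hset : π ⁻¹' {π u, π x} = {u, v, x} := by
      ext y
      rw [Set.mem_preimage, Set.mem_insert_iff, Set.mem_insert_iff, Set.mem_insert_iff,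
        Set.mem_singleton_iff, Set.mem_singleton_iff, ← or_assoc, ← h.map_eq_iff]
      refine or_congr_right ⟨fun hy => ?_, fun hy => hy ▸ rfl⟩
      exact (h.eq_of_map_eq hy.symm hux.ne' hvx.ne').symm
    rw [← hset, ← Set.preimage_compl]
    exact h.preconnected_preimage (hH _ hS).preconnected

/-- Every induced nonseparating cycle of the contraction lifts, and each common neighbour of the
contracted edge gives one further nonseparating triangle. -/
theorem ncard_nonsepCycles_add_le [Finite V] (h : IsContraction G H π u v) (hG : ThreeConnected G)
    (hH : ThreeConnected H) (hV : 5 ≤ Nat.card V) :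
    (nonsepCycles H).ncard + {x | G.Adj u x ∧ G.Adj v x}.ncard ≤ (nonsepCycles G).ncard := by
  have hW : Finite W := Finite.of_surjective π h.surj
  have hex : ∀ C : Set W, ∃ D, C ∈ nonsepCycles H → IsNonsepCycle G D ∧ π '' D = C := by
    intro C
    by_cases hC : IsNonsepCycle H C
    · obtain ⟨D, hD⟩ := h.exists_lift hG hV hC
      exact ⟨D, fun _ => hD⟩
    · exact ⟨∅, fun hC' => (hC hC').elim⟩
  choose L hL using hex
  set N : Set V := {x | G.Adj u x ∧ G.Adj v x}
  have h1 : (L '' nonsepCycles H).ncard = (nonsepCycles H).ncard := by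
    refine Set.InjOn.ncard_image fun C hC C' hC' he => ?_
    rw [← (hL C hC).2, ← (hL C' hC').2, he]
  have h2 : ((fun x => ({u, v, x} : Set V)) '' N).ncard = N.ncard := by
    refine Set.InjOn.ncard_image fun x hx y _ he => ?_
    have hxm : x ∈ ({u, v, y} : Set V) := by
      rw [← show ({u, v, x} : Set V) = {u, v, y} from he]
      simp
    rcases hxm with rfl | rfl | hxy
    · exact (G.irrefl hx.1).elim
    · exact (G.irrefl hx.2).elim
    · exact hxy
  have hdisj : Disjoint (L '' nonsepCycles H) ((fun x => ({u, v, x} : Set V)) '' N) := by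
    rw [Set.disjoint_left]
    rintro _ ⟨C, hC, rfl⟩ ⟨x, -, hx⟩
    have hC3 := hC.1.1
    rw [← (hL C hC).2, ← hx, Set.image_insert_eq, Set.image_insert_eq, Set.image_singleton,
      h.map_eq, Set.insert_idem] at hC3
    have := Set.ncard_insert_le (π v) {π x}
    rw [Set.ncard_singleton] at this
    omega
  rw [← h1, ← h2, ← Set.ncard_union_eq hdisj]
  refine Set.ncard_le_ncard ?_
  rintro _ (⟨C, hC, rfl⟩ | ⟨x, hx, rfl⟩)
  · exact (hL C hC).1
  · exact h.isNonsepCycle_triangle hH hx.1 hx.2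

end IsContraction

theorem choose_le_of_forall_adj [Finite V] {G : SimpleGraph V} (hG : ∀ x y, x ≠ y → G.Adj x y) :
    ((Nat.card V).choose 3 : ℤ) - ((Nat.card V).choose 2 : ℤ) + (Nat.card V : ℤ)
      ≤ ((nonsepCycles G).ncard : ℤ) - (G.edgeSet.ncard : ℤ) + (Nat.card V : ℤ) := by
  classical
  have := Fintype.ofFinite V
  have h1 : (Nat.card V).choose 3 ≤ (nonsepCycles G).ncard := by
    have hcard : ((fun s : Finset V => (s : Set V)) ''
        (Finset.powersetCard 3 (Finset.univ : Finset V))).ncard = (Nat.card V).choose 3 := by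
      rw [Set.ncard_image_of_injective _ Finset.coe_injective, Set.ncard_coe_finset,
        Finset.card_powersetCard, Finset.card_univ, Nat.card_eq_fintype_card]
    rw [← hcard]
    refine Set.ncard_le_ncard ?_
    rintro _ ⟨s, hs, rfl⟩
    refine ⟨isInducedCycle_of_isClique (fun x _ y _ hxy => hG x y hxy) ?_, ?_⟩
    · rw [Set.ncard_coe_finset]
      exact (Finset.mem_powersetCard.1 hs).2
    · refine preconnected_induce_iff_forall_not_splits.2 ?_
      rintro F ⟨-, ⟨x, hx⟩, ⟨y, hy⟩, hadj⟩
      exact hadj x hx y hy (hG x y fun h => hy.2 (h ▸ hx))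
  have h2 : G.edgeSet.ncard ≤ (Nat.card V).choose 2 := by
    rw [← SimpleGraph.coe_edgeFinset, Set.ncard_coe_finset, Nat.card_eq_fintype_card]
    exact G.card_edgeFinset_le_card_choose_two
  omega

theorem IsMinor.exists_isCompleteModel [Finite V] {G : SimpleGraph V} (hG : G.Preconnected) {n : ℕ}
    (hn : 0 < n) (h : IsMinor (⊤ : SimpleGraph (Fin n)) G) :
    ∃ φ : V → Fin n, IsCompleteModel G φ := by
  classical
  let P : Set (Fin n → Set V) := {f | (∀ i, (f i).Nonempty) ∧ (∀ i F, ¬ Splits G (f i) F) ∧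
    (Pairwise fun i j => Disjoint (f i) (f j)) ∧
    ∀ i j, i ≠ j → ∃ a ∈ f i, ∃ b ∈ f j, G.Adj a b}
  have hP : P.Nonempty := by
    obtain ⟨f, h1, h2, h3, h4⟩ := h
    exact ⟨f, h1, fun i => preconnected_induce_iff_forall_not_splits.1 (h2 i).preconnected, h3, h4⟩
  obtain ⟨f, ⟨hne, hconn, hdisj, hadj⟩, hmax⟩ :=
    Set.exists_max_image P (fun f => (⋃ i, f i).ncard) P.toFinite hP
  have hcover : ∀ y, ∃ i, y ∈ f i := by
    by_contra! hy
    obtain ⟨y₀, hy₀⟩ := hy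
    have huniv : ¬ Splits G Set.univ (⋃ i, f i) :=
      preconnected_induce_iff_forall_not_splits.1
        ((SimpleGraph.induceUnivIso G).preconnected_iff.2 hG) _
    obtain ⟨x, hx, y, hy, hxy⟩ : ∃ x ∈ ⋃ i, f i, ∃ y, y ∉ ⋃ i, f i ∧ G.Adj x y := by
      by_contra! hc
      refine huniv ⟨Set.subset_univ _, ?_, ⟨y₀, trivial, by simpa using hy₀⟩,
        fun x hx y hy => hc x hx y hy.2⟩
      obtain ⟨x, hx⟩ := hne ⟨0, hn⟩
      exact ⟨x, Set.mem_iUnion.2 ⟨_, hx⟩⟩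
    obtain ⟨i, hxi⟩ := Set.mem_iUnion.1 hx
    have hyf : ∀ j, y ∉ f j := by simpa using hy
    set g := Function.update f i (insert y (f i))
    have hgi : g i = insert y (f i) := Function.update_self ..
    have hgj : ∀ j, j ≠ i → g j = f j := fun j hj => Function.update_of_ne hj ..
    have hle : ∀ j, f j ⊆ g j := by
      intro j
      by_cases hj : j = i
      · rw [hj, hgi]
        exact Set.subset_insert _ _
      · rw [hgj j hj]
    have hgP : g ∈ P := by
      refine ⟨fun j => (hne j).mono (hle j), fun j F hF => ?_, fun j k hjk => ?_,
        fun j k hjk => ?_⟩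
      · by_cases hj : j = i
        · subst hj
          rw [hgi] at hF
          wlog hyF : y ∉ F generalizing F
          · exact this _ hF.compl fun h => h.2 (not_not.1 hyF)
          have hxF : x ∉ F := fun hxF => hF.2.2.2 x hxF y ⟨.inl rfl, hyF⟩ hxy
          exact hconn j F ⟨fun z hz => (hF.1 hz).resolve_left fun h => hyF (h ▸ hz), hF.2.1,
            ⟨x, hxi, hxF⟩, fun a ha b hb => hF.2.2.2 a ha b ⟨.inr hb.1, hb.2⟩⟩
        · rw [hgj j hj] at hF
          exact hconn j F hF
      · change Disjoint (g j) (g k)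
        by_cases hj : j = i
        · subst hj
          rw [hgi, hgj k hjk.symm, Set.disjoint_insert_left]
          exact ⟨hyf k, hdisj hjk⟩
        · by_cases hk : k = i
          · subst hk
            rw [hgi, hgj j hj, Set.disjoint_insert_right]
            exact ⟨hyf j, hdisj hjk⟩
          · rw [hgj j hj, hgj k hk]
            exact hdisj hjk
      · obtain ⟨a, ha, b, hb, hab⟩ := hadj j k hjk
        exact ⟨a, hle j ha, b, hle k hb, hab⟩
    refine (hmax g hgP).not_gt (Set.ncard_lt_ncard ⟨Set.iUnion_mono hle, fun hss => hy ?_⟩)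
    exact hss (Set.mem_iUnion.2 ⟨i, hgi ▸ Set.mem_insert _ _⟩)
  choose φ hφ using hcover
  have hφi : ∀ i x, x ∈ f i → φ x = i := by
    intro i x hx
    by_contra hc
    exact Set.disjoint_left.1 (hdisj hc) (hφ x) hx
  have hpre : ∀ i, φ ⁻¹' {i} = f i := by
    intro i
    ext x
    exact ⟨fun h => h ▸ hφ x, hφi i x⟩
  refine ⟨φ, fun i => ?_, fun i => hpre i ▸ hconn i, fun i j hij => ?_⟩
  · obtain ⟨x, hx⟩ := hne i
    exact ⟨x, hφi i x hx⟩
  · obtain ⟨a, ha, b, hb, hab⟩ := hadj i j hij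
    exact ⟨a, b, hφi i a ha, hφi j b hb, hab⟩

theorem IsMinor.le_card [Finite V] {G : SimpleGraph V} {n : ℕ}
    (h : IsMinor (⊤ : SimpleGraph (Fin n)) G) : n ≤ Nat.card V := by
  obtain ⟨f, hne, -, hdisj, -⟩ := h
  choose g hg using hne
  have hinj : Function.Injective g := fun i j hij => by
    by_contra hc
    exact Set.disjoint_left.1 (hdisj hc) (hg i) (hij ▸ hg j)
  simpa using Nat.card_le_card_of_injective g hinj

theorem isMinor_hadwigerNumber [Finite V] (G : SimpleGraph V) :
    IsMinor (⊤ : SimpleGraph (Fin (hadwigerNumber G))) G :=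
  Nat.sSup_mem (s := {n | IsMinor (⊤ : SimpleGraph (Fin n)) G})
    ⟨0, fun i => i.elim0, fun i => i.elim0, fun i => i.elim0, fun i => i.elim0, fun i => i.elim0⟩
    ⟨Nat.card V, fun _ h => h.le_card⟩

theorem hadwigerNumber_pos [Finite V] [Nonempty V] (G : SimpleGraph V) :
    0 < hadwigerNumber G := by
  refine le_csSup (s := {n | IsMinor (⊤ : SimpleGraph (Fin n)) G})
    ⟨Nat.card V, fun _ h => h.le_card⟩ ?_
  refine ⟨fun _ => {Classical.arbitrary V}, fun _ => Set.singleton_nonempty _, fun _ => ?_,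
    fun i j hij => (hij (Subsingleton.elim i j)).elim,
    fun i j hij => (hij.ne (Subsingleton.elim i j)).elim⟩
  have : Nonempty ({Classical.arbitrary V} : Set V) := ⟨⟨_, rfl⟩⟩
  exact ⟨.of_subsingleton⟩

theorem choose_sub_choose_add_mono {m n : ℕ} (hm : 0 < m) (hmn : m ≤ n) :
    (m.choose 3 : ℤ) - (m.choose 2 : ℤ) + (m : ℤ)
      ≤ (n.choose 3 : ℤ) - (n.choose 2 : ℤ) + (n : ℤ) := by
  induction n, hmn using Nat.le_induction with
  | base => rfl
  | succ k hk ih =>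
    obtain ⟨j, rfl⟩ : ∃ j, k = j + 1 := ⟨k - 1, by omega⟩
    have h3 := Nat.choose_succ_succ (j + 1) 2
    have h2 := Nat.choose_succ_succ (j + 1) 1
    have h1 := Nat.choose_succ_succ j 1
    simp only [Nat.succ_eq_add_one, Nat.reduceAdd, Nat.choose_one_right] at h1 h2 h3
    rw [h3, h2]
    push_cast
    omega

theorem IsCompleteModel.choose_le {n : ℕ} (hn : 0 < n) (k : ℕ) : ∀ {V : Type*} [Finite V]
    {G : SimpleGraph V}, ThreeConnected G → ∀ {φ : V → Fin n}, IsCompleteModel G φ →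
    Nat.card V ≤ k → (n.choose 3 : ℤ) - (n.choose 2 : ℤ) + (n : ℤ)
      ≤ ((nonsepCycles G).ncard : ℤ) - (G.edgeSet.ncard : ℤ) + (Nat.card V : ℤ) := by
  induction k with
  | zero =>
    intro V _ G _ φ hφ hV
    have := Nat.card_le_card_of_surjective φ hφ.surj
    rw [Nat.card_fin] at this
    omega
  | succ k ih =>
    intro V _ G hG φ hφ hV
    have hnV := Nat.card_le_card_of_surjective φ hφ.surj
    rw [Nat.card_fin] at hnV
    by_cases hV4 : Nat.card V ≤ 4
    · exact (choose_sub_choose_add_mono hn hnV).trans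
        (choose_le_of_forall_adj fun x y hxy => hG.adj_of_card_le hV4 hxy)
    by_cases hinj : Function.Injective φ
    · refine (choose_sub_choose_add_mono hn hnV).trans (choose_le_of_forall_adj fun x y hxy => ?_)
      obtain ⟨a, b, ha, hb, hab⟩ := hφ.adj _ _ (hinj.ne hxy)
      rwa [← hinj ha, ← hinj hb]
    obtain ⟨ψ, u, v, hψ, hψuv, huv, hcut⟩ := exists_edge_without_three_cut hG hφ hinj
    obtain ⟨H, π, h⟩ := exists_isContraction huv
    have hcard := h.card_eq
    have hH := h.threeConnected hG (by omega) hcut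
    obtain ⟨χ, hχ⟩ := h.exists_isCompleteModel hψ hψuv
    have h1 := ih hH hχ (by omega)
    have h2 := h.ncard_edgeSet_le
    have h3 := h.ncard_nonsepCycles_add_le hG hH (by omega)
    omega

/-- For every finite simple 3-connected graph `G`,
`C(h(G),3) - C(h(G),2) + C(h(G),1) ≤ |C(G)| - |E(G)| + |V(G)|`. -/
theorem stmt0 [Finite V] (G : SimpleGraph V) (hG : ThreeConnected G) :
    ((hadwigerNumber G).choose 3 : ℤ) - ((hadwigerNumber G).choose 2 : ℤ)
        + ((hadwigerNumber G).choose 1 : ℤ)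
      ≤ ((nonsepCycles G).ncard : ℤ) - (G.edgeSet.ncard : ℤ) + (Nat.card V : ℤ) := by
  have hconn : G.Connected := by
    have h := hG ∅ (by simp)
    rw [Set.compl_empty] at h
    exact (SimpleGraph.induceUnivIso G).connected_iff.1 h
  have := hconn.nonempty
  have hpos := hadwigerNumber_pos G
  obtain ⟨φ, hφ⟩ := (isMinor_hadwigerNumber G).exists_isCompleteModel hconn.preconnected hpos
  rw [Nat.choose_one_right]
  exact hφ.choose_le hpos _ hG le_rfl
end

section
/- Let G be a finite simple 3-connected graph that admits an over-dominating k-colouring. Then |E(G)| - |V(G)| + (1/6)⌊2k/3⌋³ - (1/2)⌊2k/3⌋² + (1/3)⌊2k/3⌋ + 1 ≤ |C(G)|, where C(G) is the set of induced nonseparating cycles of G. -/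
open SimpleGraph

variable {V : Type*} {W : Type*}

/-- `f` is an over-dominating proper colouring of `G` with `k` colour classes:
it is proper and surjective onto the `k` colours, every vertex has a neighbour
in each colour class other than its own, and for each pair of colour classes
one of them has a vertex adjacent to all vertices of the other. -/
def IsOverDominating (G : SimpleGraph V) {k : ℕ} (f : V → Fin k) : Prop :=
  (∀ ⦃x y : V⦄, G.Adj x y → f x ≠ f y) ∧
  Function.Surjective f ∧
  (∀ x : V, ∀ c : Fin k, c ≠ f x → ∃ y, G.Adj x y ∧ f y = c) ∧
  (∀ c₁ c₂ : Fin k, c₁ ≠ c₂ →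
    (∃ x, f x = c₁ ∧ ∀ y, f y = c₂ → G.Adj x y) ∨
    (∃ x, f x = c₂ ∧ ∀ y, f y = c₁ → G.Adj x y))

namespace SimpleGraph

/-- Binary edge weights summed along a walk. -/
def Walk.weight {G : SimpleGraph V} (w : Sym2 V → ZMod 2) {u v : V} (p : G.Walk u v) : ZMod 2 :=
  (p.edges.map w).sum

/-- Every closed walk inside `S` has total weight zero. -/
def BalancedOn (G : SimpleGraph V) (w : Sym2 V → ZMod 2) (S : Set V) : Prop :=
  ∀ (u : V) (p : G.Walk u u), (∀ x ∈ p.support, x ∈ S) → p.weight w = 0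

/-- A shortest closed walk of nonzero weight inside `S`. -/
structure Walk.IsShortestUnbalanced {G : SimpleGraph V} (w : Sym2 V → ZMod 2) (S : Set V) {u : V}
    (p : G.Walk u u) : Prop where
  support_subset : ∀ x ∈ p.support, x ∈ S
  weight_ne_zero : p.weight w ≠ 0
  length_le : ∀ (v : V) (q : G.Walk v v), (∀ x ∈ q.support, x ∈ S) → q.weight w ≠ 0 →
    p.length ≤ q.length

/-- Any two vertices of `A` are joined by a walk inside `A`. -/
def WalkConnectedOn (G : SimpleGraph V) (A : Set V) : Prop :=
  ∀ x ∈ A, ∀ y ∈ A, ∃ p : G.Walk x y, ∀ z ∈ p.support, z ∈ A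

section Weight

variable {G : SimpleGraph V} {w : Sym2 V → ZMod 2} {S : Set V}

namespace Walk

@[simp] lemma weight_nil {u : V} : (nil : G.Walk u u).weight w = 0 := by simp [weight]

@[simp] lemma weight_cons {u v x : V} (h : G.Adj u v) (p : G.Walk v x) :
    (cons h p).weight w = w s(u, v) + p.weight w := by simp [weight]

@[simp] lemma weight_append {u v x : V} (p : G.Walk u v) (q : G.Walk v x) :
    (p.append q).weight w = p.weight w + q.weight w := by simp [weight]

@[simp] lemma weight_reverse {u v : V} (p : G.Walk u v) : p.reverse.weight w = p.weight w := by
  simp [weight]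

lemma weight_eq_zero {u v : V} (p : G.Walk u v) (hp : ∀ x ∈ p.support, x ∈ S)
    (hw : ∀ x ∈ S, ∀ y ∈ S, w s(x, y) = 0) : p.weight w = 0 := by
  induction p with
  | nil => simp
  | cons h p ih =>
    simp only [support_cons, List.mem_cons, forall_eq_or_imp] at hp
    rw [weight_cons, ih hp.2, hw _ hp.1 _ (hp.2 _ p.start_mem_support), add_zero]

lemma weight_rotate [DecidableEq V] {u v : V} (p : G.Walk u u) (h : v ∈ p.support) :
    (p.rotate v h).weight w = p.weight w :=
  ((p.rotate_edges v h).perm.map w).sum_eq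

lemma exists_closed_subwalk {u v : V} (p : G.Walk u v) (hp : ¬ p.IsPath) :
    ∃ (x : V) (a : G.Walk u x) (b : G.Walk x x) (c : G.Walk x v),
      p = a.append (b.append c) ∧ 0 < b.length := by
  classical
  induction p with
  | nil => simp at hp
  | @cons u y v h p ih =>
    by_cases hq : p.IsPath
    · have hu : u ∈ p.support := by
        by_contra hu
        exact hp (hq.cons hu)
      refine ⟨u, nil, cons h (p.takeUntil u hu), p.dropUntil u hu, ?_, by simp⟩
      simp
    · obtain ⟨x, a, b, c, rfl, hb⟩ := ih hq
      exact ⟨x, cons h a, b, c, by simp, hb⟩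

namespace IsShortestUnbalanced

variable {u : V} {p : G.Walk u u}

lemma rotate [DecidableEq V] (hp : p.IsShortestUnbalanced w S) {v : V} (h : v ∈ p.support) :
    (p.rotate v h).IsShortestUnbalanced w S where
  support_subset x hx := hp.support_subset x (by simpa using hx)
  weight_ne_zero := by rw [weight_rotate]; exact hp.weight_ne_zero
  length_le v q hq hqw := by simpa using hp.length_le v q hq hqw

lemma isCycle (hp : p.IsShortestUnbalanced w S) : p.IsCycle := by
  rw [isCycle_iff_isPath_tail_and_le_length]
  cases p with
  | nil => exact absurd weight_nil hp.weight_ne_zero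
  | @cons _ v _ h q =>
    refine ⟨?_, ?_⟩
    · simp only [getVert_cons_succ, tail_cons, isPath_copy]
      by_contra hq
      obtain ⟨x, a, b, c, rfl, hb⟩ := q.exists_closed_subwalk hq
      have hsub := hp.support_subset
      simp only [support_cons, List.mem_cons, mem_support_append_iff] at hsub
      have h1 := hp.length_le x b (fun y hy => hsub y (by tauto))
      have h2 := hp.length_le u (cons h (a.append c)) (fun y hy => hsub y (by
        simp only [support_cons, List.mem_cons, mem_support_append_iff] at hy
        tauto))
      have h3 := hp.weight_ne_zero
      simp only [weight_cons, weight_append, length_cons, length_append] at h1 h2 h3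
      by_cases hbw : b.weight w = 0
      · have := h2 (by rwa [hbw, zero_add] at h3)
        omega
      · have := h1 hbw
        omega
    · have hw := hp.weight_ne_zero
      cases q with
      | nil => exact absurd h G.irrefl
      | cons h' r =>
        cases r with
        | nil =>
          simp only [weight_cons, weight_nil, add_zero] at hw
          rw [Sym2.eq_swap, CharTwo.add_self_eq_zero] at hw
          exact absurd rfl hw
        | cons h'' r => simp

lemma mem_edges (hp : p.IsShortestUnbalanced w S) {x y : V} (hx : x ∈ p.support)
    (hy : y ∈ p.support) (h : G.Adj x y) : s(x, y) ∈ p.edges := by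
  classical
  rw [← (p.rotate_edges x hx).mem_iff]
  have hy' : y ∈ (p.rotate x hx).support := by simpa using hy
  have hq := hp.rotate hx
  generalize p.rotate x hx = q at hy' hq
  obtain ⟨a, b, rfl⟩ : ∃ (a : G.Walk x y) (b : G.Walk y x), q = a.append b :=
    ⟨_, _, (q.take_spec hy').symm⟩
  by_contra hxy
  simp only [edges_append, List.mem_append, not_or] at hxy
  have key : ∀ {x y : V} (a : G.Walk x y), G.Adj x y → s(x, y) ∉ a.edges → 1 < a.length := by
    intro x y a h hxy
    cases a with
    | nil => exact absurd h G.irrefl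
    | cons h' r =>
      cases r with
      | nil => simp at hxy
      | cons h'' r => simp
  have ha := key a h hxy.1
  have hb := key b h.symm (by rw [Sym2.eq_swap]; exact hxy.2)
  have hsub := hq.support_subset
  simp only [mem_support_append_iff] at hsub
  have h1 := hq.length_le y (cons h.symm a) (fun z hz => hsub z (by
    simp only [support_cons, List.mem_cons] at hz
    rcases hz with rfl | hz
    · exact Or.inl a.end_mem_support
    · exact Or.inl hz))
  have h2 := hq.length_le x (cons h b) (fun z hz => hsub z (by
    simp only [support_cons, List.mem_cons] at hz
    rcases hz with rfl | hz
    · exact Or.inr b.end_mem_support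
    · exact Or.inr hz))
  have h3 := hq.weight_ne_zero
  simp only [weight_cons, weight_append, length_cons, length_append] at h1 h2 h3
  by_cases h4 : w s(y, x) + a.weight w = 0
  · have := h2 (fun h5 => h3 (by
      rw [Sym2.eq_swap] at h4
      linear_combination h4 + h5 - CharTwo.add_self_eq_zero (w s(x, y))))
    omega
  · have := h1 h4
    omega

lemma mem_support (hp : p.IsShortestUnbalanced w S) {x : V}
    (hx : G.BalancedOn w (S \ {x})) : x ∈ p.support := by
  by_contra h
  exact hp.weight_ne_zero (hx u p fun y hy => ⟨hp.support_subset y hy, by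
    rintro rfl; exact h hy⟩)

end IsShortestUnbalanced

end Walk

lemma exists_isShortestUnbalanced (h : ¬ G.BalancedOn w S) :
    ∃ (u : V) (p : G.Walk u u), p.IsShortestUnbalanced w S := by
  classical
  have hex : ∃ n, ∃ (u : V) (p : G.Walk u u), (∀ x ∈ p.support, x ∈ S) ∧ p.weight w ≠ 0 ∧
      p.length = n := by
    simp only [BalancedOn, not_forall] at h
    obtain ⟨u, p, hp, hw⟩ := h
    exact ⟨_, u, p, hp, hw, rfl⟩
  obtain ⟨u, p, hp, hw, hn⟩ := Nat.find_spec hex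
  exact ⟨u, p, hp, hw, fun v q hq hqw => hn ▸ Nat.find_min' hex ⟨v, q, hq, hqw, rfl⟩⟩

lemma WalkConnectedOn.preconnected {A : Set V} (h : G.WalkConnectedOn A) :
    (G.induce A).Preconnected := by
  rintro ⟨x, hx⟩ ⟨y, hy⟩
  obtain ⟨p, hp⟩ := h x hx y hy
  exact ⟨p.induce A hp⟩

lemma Preconnected.walkConnectedOn {A : Set V} (h : (G.induce A).Preconnected) :
    G.WalkConnectedOn A := by
  intro x hx y hy
  obtain ⟨p⟩ := h ⟨x, hx⟩ ⟨y, hy⟩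
  refine ⟨p.map (Embedding.induce A).toHom, fun z hz => ?_⟩
  replace hz : z ∈ p.support.map (Embedding.induce (G := G) A).toHom := by
    rw [← Walk.support_map]
    exact hz
  obtain ⟨z', -, rfl⟩ := List.mem_map.1 hz
  exact z'.2

lemma WalkConnectedOn.insert {A : Set V} (h : G.WalkConnectedOn A) {a x : V} (ha : a ∈ A)
    (hax : G.Adj a x) : G.WalkConnectedOn (insert x A) := by
  have key : ∀ y ∈ A, ∃ p : G.Walk x y, ∀ z ∈ p.support, z ∈ Insert.insert x A := by
    intro y hy
    obtain ⟨p, hp⟩ := h a ha y hy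
    refine ⟨Walk.cons hax.symm p, fun z hz => ?_⟩
    rw [Walk.support_cons, List.mem_cons] at hz
    exact hz.imp id (hp z)
  rintro y (rfl | hy) z (rfl | hz)
  · exact ⟨Walk.nil, by simp⟩
  · exact key z hz
  · obtain ⟨p, hp⟩ := key y hy
    exact ⟨p.reverse, by simpa using hp⟩
  · obtain ⟨p, hp⟩ := h y hy z hz
    exact ⟨p, fun t ht => Or.inr (hp t ht)⟩

open Classical in
/-- The total weight of the edges of `G` with both ends in `D`. -/
noncomputable def inducedWeight [Fintype V] (G : SimpleGraph V) (D : Set V)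
    (w : Sym2 V → ZMod 2) : ZMod 2 :=
  ∑ e ∈ Finset.univ.filter (fun e => e ∈ G.edgeSet ∧ ∀ x ∈ e, x ∈ D), w e

lemma isInducedCycle_of_critical [Fintype V] (h : ¬ G.BalancedOn w S)
    (hS : ∀ x ∈ S, G.BalancedOn w (S \ {x})) :
    IsInducedCycle G S ∧ G.inducedWeight S w ≠ 0 := by
  classical
  obtain ⟨u, p, hp⟩ := exists_isShortestUnbalanced h
  have hc := hp.isCycle
  have hmem : ∀ x, x ∈ S ↔ x ∈ p.support :=
    fun x => ⟨fun hx => hp.mem_support (hS x hx), hp.support_subset x⟩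
  refine ⟨⟨?_, ?_, ?_⟩, ?_⟩
  · have h1 : ((p.support.tail.toFinset : Finset V) : Set V) ⊆ S := by
      intro x hx
      exact (hmem x).2 (List.mem_of_mem_tail (by simpa using hx))
    have h2 := Set.ncard_le_ncard h1
    rw [Set.ncard_coe_finset, List.toFinset_card_of_nodup hc.support_nodup] at h2
    have := hc.three_le_length
    simp only [List.length_tail, Walk.length_support] at h2
    omega
  · have := p.connected_induce_support
    rwa [show {v | v ∈ p.support} = S from (Set.ext hmem).symm] at this
  · rintro ⟨x, hx⟩
    rw [← hc.ncard_neighborSet_toSubgraph_eq_two ((hmem x).1 hx),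
      ← Set.ncard_image_of_injective _ Subtype.val_injective]
    congr 1
    ext y
    simp only [Set.mem_image, mem_neighborSet, comap_adj, Function.Embedding.subtype_apply,
      Subtype.exists, exists_and_right, exists_eq_right, Subgraph.mem_neighborSet]
    rw [Walk.adj_toSubgraph_iff_mem_edges]
    constructor
    · rintro ⟨hy, hxy⟩
      exact hp.mem_edges ((hmem x).1 hx) ((hmem y).1 hy) hxy
    · intro hxy
      exact ⟨(hmem y).2 (p.snd_mem_support_of_mem_edges hxy), p.adj_of_mem_edges hxy⟩
  · convert hp.weight_ne_zero using 1
    rw [Walk.weight, ← List.sum_toFinset _ hc.edges_nodup, inducedWeight]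
    refine Finset.sum_congr ?_ fun _ _ => rfl
    ext e
    induction e using Sym2.ind with
    | _ x y =>
    simp only [Finset.mem_filter, Finset.mem_univ, true_and, mem_edgeSet, Sym2.mem_iff,
      forall_eq_or_imp, forall_eq, List.mem_toFinset]
    constructor
    · rintro ⟨hxy, hx, hy⟩
      exact hp.mem_edges ((hmem x).1 hx) ((hmem y).1 hy) hxy
    · intro hxy
      exact ⟨p.adj_of_mem_edges hxy, (hmem x).2 (p.fst_mem_support_of_mem_edges hxy),
        (hmem y).2 (p.snd_mem_support_of_mem_edges hxy)⟩

end Weight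

end SimpleGraph
namespace SimpleGraph

section Spanning

variable {G : SimpleGraph V} {w : Sym2 V → ZMod 2} {S : Set V}

lemma weight_eq_zero_of_arcs {a b c y : V} {R : Set V} (hR : R ⊆ S)
    (haS : a ∈ S) (hbS : b ∈ S) (hcS : c ∈ S) (ha : a ∉ R) (hb : b ∉ R) (hc : c ∉ R)
    (hab : a ≠ b) (hac : a ≠ c) (hbc : b ≠ c)
    (hBa : G.BalancedOn w (S \ {a})) (hBb : G.BalancedOn w (S \ {b}))
    (hBc : G.BalancedOn w (S \ {c}))
    (qa : G.Walk y a) (qb : G.Walk y b) (qc : G.Walk y c)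
    (hqa : ∀ z ∈ qa.support, z = a ∨ z ∈ R) (hqb : ∀ z ∈ qb.support, z = b ∨ z ∈ R)
    (hqc : ∀ z ∈ qc.support, z = c ∨ z ∈ R)
    (p : G.Walk a b) (q : G.Walk b c) (r : G.Walk c a)
    (hp : ∀ z ∈ p.support, z ∈ S \ {c}) (hq : ∀ z ∈ q.support, z ∈ S \ {a})
    (hr : ∀ z ∈ r.support, z ∈ S \ {b}) :
    p.weight w + q.weight w + r.weight w = 0 := by
  have key : ∀ {s t x : V} (qs : G.Walk y s) (qt : G.Walk y t) (p : G.Walk s t),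
      G.BalancedOn w (S \ {x}) → s ∈ S → t ∈ S → s ≠ x → t ≠ x → x ∉ R →
      (∀ z ∈ qs.support, z = s ∨ z ∈ R) → (∀ z ∈ qt.support, z = t ∨ z ∈ R) →
      (∀ z ∈ p.support, z ∈ S \ {x}) → qs.weight w + p.weight w + qt.weight w = 0 := by
    intro s t x qs qt p hB hs ht hsx htx hx hqs hqt hp
    have hRx : ∀ z ∈ R, z ∈ S \ {x} := fun z hz => ⟨hR hz, fun h => hx (h ▸ hz)⟩
    have := hB y (qs.append (p.append qt.reverse)) (fun z hz => by
      simp only [Walk.mem_support_append_iff, Walk.support_reverse, List.mem_reverse] at hz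
      rcases hz with hz | hz | hz
      · rcases hqs z hz with rfl | h
        exacts [⟨hs, hsx⟩, hRx z h]
      · exact hp z hz
      · rcases hqt z hz with rfl | h
        exacts [⟨ht, htx⟩, hRx z h])
    simpa [add_assoc] using this
  have h1 := key qa qb p hBc haS hbS hac hbc hc hqa hqb hp
  have h2 := key qb qc q hBa hbS hcS hab.symm hac.symm ha hqb hqc hq
  have h3 := key qc qa r hBb hcS haS hbc.symm hab hb hqc hqa hr
  linear_combination h1 + h2 + h3 - CharTwo.add_self_eq_zero (qa.weight w)
    - CharTwo.add_self_eq_zero (qb.weight w) - CharTwo.add_self_eq_zero (qc.weight w)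

namespace Walk

lemma arcs_avoid {a b c : V} {p : G.Walk a b} {q : G.Walk b c} {r : G.Walk c a}
    (h : (p.append (q.append r)).support.tail.Nodup) (hab : a ≠ b) (hac : a ≠ c) (hbc : b ≠ c) :
    c ∉ p.support ∧ a ∉ q.support ∧ b ∉ r.support := by
  simp only [tail_support_append, List.nodup_append', List.disjoint_append_right] at h
  obtain ⟨-, ⟨-, -, hqr⟩, hpq, hpr⟩ := h
  have hb := p.end_mem_tail_support_of_ne hab
  have hc := q.end_mem_tail_support_of_ne hbc
  have ha := r.end_mem_tail_support_of_ne hac.symm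
  simp only [mem_support_iff, not_or]
  exact ⟨⟨hac.symm, fun h => hpq h hc⟩, ⟨hab, fun h => hqr h ha⟩, hbc, fun h => hpr hb h⟩

lemma IsShortestUnbalanced.not_tripod {u : V} {p : G.Walk u u} (hp : p.IsShortestUnbalanced w S)
    {a b c y : V} {R : Set V} (hR : R ⊆ S)
    (haS : a ∈ S) (hbS : b ∈ S) (hcS : c ∈ S) (ha : a ∉ R) (hb : b ∉ R) (hc : c ∉ R)
    (hab : a ≠ b) (hac : a ≠ c) (hbc : b ≠ c)
    (hBa : G.BalancedOn w (S \ {a})) (hBb : G.BalancedOn w (S \ {b}))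
    (hBc : G.BalancedOn w (S \ {c}))
    (qa : G.Walk y a) (qb : G.Walk y b) (qc : G.Walk y c)
    (hqa : ∀ z ∈ qa.support, z = a ∨ z ∈ R) (hqb : ∀ z ∈ qb.support, z = b ∨ z ∈ R)
    (hqc : ∀ z ∈ qc.support, z = c ∨ z ∈ R) : False := by
  classical
  have hpa := hp.rotate (hp.mem_support hBa)
  generalize p.rotate a _ = p' at hpa
  have hb' := hpa.mem_support hBb
  have hc' := hpa.mem_support hBc
  obtain ⟨s, t, rfl⟩ : ∃ (s : G.Walk a b) (t : G.Walk b a), p' = s.append t :=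
    ⟨_, _, (p'.take_spec hb').symm⟩
  have hnd := hpa.isCycle.support_nodup
  have hsub := hpa.support_subset
  have hwt := hpa.weight_ne_zero
  rw [mem_support_append_iff] at hc'
  rcases hc' with hc' | hc'
  · obtain ⟨s₁, s₂, rfl⟩ : ∃ (s₁ : G.Walk a c) (s₂ : G.Walk c b), s = s₁.append s₂ :=
      ⟨_, _, (s.take_spec hc').symm⟩
    rw [← append_assoc] at hnd hsub hwt
    obtain ⟨h1, h2, h3⟩ := arcs_avoid hnd hac hab hbc.symm
    simp only [mem_support_append_iff] at hsub
    apply hwt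
    rw [weight_append, weight_append, ← add_assoc]
    exact weight_eq_zero_of_arcs hR haS hcS hbS ha hc hb hac hab hbc.symm hBa hBc hBb qa qc qb
      hqa hqc hqb _ _ _ (fun z hz => ⟨hsub z (by tauto), fun h => h1 (h ▸ hz)⟩)
      (fun z hz => ⟨hsub z (by tauto), fun h => h2 (h ▸ hz)⟩)
      (fun z hz => ⟨hsub z (by tauto), fun h => h3 (h ▸ hz)⟩)
  · obtain ⟨t₁, t₂, rfl⟩ : ∃ (t₁ : G.Walk b c) (t₂ : G.Walk c a), t = t₁.append t₂ :=
      ⟨_, _, (t.take_spec hc').symm⟩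
    obtain ⟨h1, h2, h3⟩ := arcs_avoid hnd hab hac hbc
    simp only [mem_support_append_iff] at hsub
    apply hwt
    rw [weight_append, weight_append, ← add_assoc]
    exact weight_eq_zero_of_arcs hR haS hbS hcS ha hb hc hab hac hbc hBa hBb hBc qa qb qc
      hqa hqb hqc _ _ _ (fun z hz => ⟨hsub z (by tauto), fun h => h1 (h ▸ hz)⟩)
      (fun z hz => ⟨hsub z (by tauto), fun h => h2 (h ▸ hz)⟩)
      (fun z hz => ⟨hsub z (by tauto), fun h => h3 (h ▸ hz)⟩)

end Walk

/-- In a 3-connected graph, if the vertices of an unbalanced set `Aᶜ` adjacent to `A` are all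
critical for unbalance, then every vertex of `Aᶜ` is adjacent to `A`. -/
lemma exists_adj_of_critical [Finite V] (hG : ThreeConnected G) {A : Set V} (hne : A.Nonempty)
    (hA : ¬ G.BalancedOn w Aᶜ)
    (hcrit : ∀ x ∉ A, (∃ a ∈ A, G.Adj a x) → G.BalancedOn w (Aᶜ \ {x})) {y : V} (hy : y ∉ A) :
    ∃ a ∈ A, G.Adj a y := by
  by_contra hyN
  set R : Set V := {z | z ∉ A ∧ ¬ ∃ a ∈ A, G.Adj a z}
  set Y : Set V := {z | ∃ q : G.Walk y z, ∀ t ∈ q.support, t ∈ R}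
  set M : Set V := {n | n ∉ A ∧ (∃ a ∈ A, G.Adj a n) ∧ ∃ z ∈ Y, G.Adj z n}
  have hYR : Y ⊆ R := fun z ⟨q, hq⟩ => hq z q.end_mem_support
  have hyY : y ∈ Y := ⟨Walk.nil, by simpa using ⟨hy, hyN⟩⟩
  have hcard : 2 < M.ncard := by
    by_contra hle
    obtain ⟨a₀, ha₀⟩ := hne
    obtain ⟨p, hp⟩ := (hG M (not_lt.1 hle)).preconnected.walkConnectedOn y
      (fun h => hyN h.2.1) a₀ (fun h => h.1 ha₀)
    have hclosed : ∀ {s t : V} (p : G.Walk s t), (∀ z ∈ p.support, z ∉ M) → s ∈ Y → t ∈ Y := by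
      intro s t p
      induction p with
      | nil => exact fun _ h => h
      | @cons s x t h p ih =>
        intro hp hs
        simp only [Walk.support_cons, List.mem_cons, forall_eq_or_imp] at hp
        refine ih hp.2 ?_
        obtain ⟨q, hq⟩ := hs
        have hsR := hq s q.end_mem_support
        have hxA : x ∉ A := fun hx => hsR.2 ⟨x, hx, h.symm⟩
        have hxR : x ∈ R := ⟨hxA, fun hx => hp.2 x p.start_mem_support ⟨hxA, hx, s, ⟨q, hq⟩, h⟩⟩
        refine ⟨q.concat h, fun z hz => ?_⟩
        rw [Walk.support_concat, List.mem_append,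
          List.mem_singleton] at hz
        rcases hz with hz | rfl
        exacts [hq z hz, hxR]
    exact (hYR (hclosed p hp hyY)).1 ha₀
  obtain ⟨a, b, c, ha, hb, hc, hab, hac, hbc⟩ := (Set.two_lt_ncard_iff).1 hcard
  have hwalk : ∀ n ∈ M, ∃ q : G.Walk y n, ∀ z ∈ q.support, z = n ∨ z ∈ R := by
    rintro n ⟨-, -, z, ⟨q, hq⟩, hzn⟩
    refine ⟨q.concat hzn, fun t ht => ?_⟩
    rw [Walk.support_concat, List.mem_append, List.mem_singleton] at ht
    exact ht.symm.imp id (hq t)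
  have hMR : ∀ n ∈ M, n ∉ R := fun n hn h => h.2 hn.2.1
  obtain ⟨u, p, hp⟩ := exists_isShortestUnbalanced hA
  obtain ⟨qa, hqa⟩ := hwalk a ha
  obtain ⟨qb, hqb⟩ := hwalk b hb
  obtain ⟨qc, hqc⟩ := hwalk c hc
  exact hp.not_tripod (R := R) (fun z hz => hz.1) ha.1 hb.1 hc.1 (hMR a ha) (hMR b hb) (hMR c hc)
    hab hac hbc (hcrit a ha.1 ha.2.1) (hcrit b hb.1 hb.2.1) (hcrit c hc.1 hc.2.1) qa qb qc
    hqa hqb hqc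

/-- Dual form of Tutte's theorem relative to a connected set `B`: the induced nonseparating cycles
avoiding `B` control the balance of all closed walks avoiding `B`. -/
theorem balancedOn_compl_of_nonsepCycles [Fintype V] (hG : ThreeConnected G) {B : Set V}
    (hne : B.Nonempty) (hB : G.WalkConnectedOn B)
    (hw : ∀ D ∈ nonsepCycles G, Disjoint D B → G.inducedWeight D w = 0) :
    G.BalancedOn w Bᶜ := by
  by_contra hunb
  obtain ⟨A, hBA, hmax⟩ := Finite.exists_le_maximal
    (p := fun A : Set V => G.WalkConnectedOn A ∧ ¬ G.BalancedOn w Aᶜ) ⟨hB, hunb⟩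
  have hcrit : ∀ x ∉ A, (∃ a ∈ A, G.Adj a x) → G.BalancedOn w (Aᶜ \ {x}) := by
    rintro x hx ⟨a, ha, hax⟩
    by_contra h
    have h2 := hmax.le_of_ge (y := insert x A)
      ⟨hmax.prop.1.insert ha hax, by
        rwa [show (insert x A)ᶜ = Aᶜ \ {x} by ext z; simp [and_comm]]⟩
      (Set.subset_insert x A)
    exact hx (h2 (Set.mem_insert x A))
  have hadj := fun y (hy : y ∉ A) => exists_adj_of_critical hG (hne.mono hBA) hmax.prop.2 hcrit hy
  obtain ⟨hcyc, hwt⟩ := isInducedCycle_of_critical hmax.prop.2 fun x hx => hcrit x hx (hadj x hx)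
  refine hwt (hw _ ⟨hcyc, ?_⟩ (Set.disjoint_left.2 fun x hx hxB => hx (hBA hxB)))
  rw [compl_compl]
  exact hmax.prop.1.preconnected

/-- Dual form of Tutte's theorem on induced nonseparating cycles. -/
theorem balancedOn_univ_of_nonsepCycles [Fintype V] (hG : ThreeConnected G)
    (hw : ∀ D ∈ nonsepCycles G, G.inducedWeight D w = 0) : G.BalancedOn w Set.univ := by
  by_contra hunb
  obtain ⟨hcyc, hwt⟩ := isInducedCycle_of_critical hunb fun x _ => by
    have := balancedOn_compl_of_nonsepCycles hG (w := w) (Set.singleton_nonempty x)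
      (by rintro y rfl z rfl; exact ⟨Walk.nil, by simp⟩) fun D hD _ => hw D hD
    rwa [Set.compl_eq_univ_sdiff] at this
  refine hwt (hw _ ⟨hcyc, ?_⟩)
  rintro ⟨x, hx⟩
  simp at hx

end Spanning

end SimpleGraph
namespace SimpleGraph

section Counting

variable {G : SimpleGraph V}

/-- The edge weight induced by a vertex potential. -/
def coboundary (p : V → ZMod 2) : Sym2 V → ZMod 2 :=
  Sym2.lift ⟨fun x y => p x + p y, fun _ _ => add_comm _ _⟩

@[simp] lemma coboundary_mk (p : V → ZMod 2) (x y : V) : coboundary p s(x, y) = p x + p y := rfl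

lemma inducedWeight_congr [Fintype V] {D : Set V} {w w' : Sym2 V → ZMod 2}
    (h : ∀ x ∈ D, ∀ y ∈ D, G.Adj x y → w s(x, y) = w' s(x, y)) :
    G.inducedWeight D w = G.inducedWeight D w' := by
  refine Finset.sum_congr rfl fun e he => ?_
  induction e using Sym2.ind with
  | _ x y =>
  simp only [Finset.mem_filter, Finset.mem_univ, true_and, mem_edgeSet, Sym2.mem_iff,
    forall_eq_or_imp, forall_eq] at he
  exact h x he.2.1 y he.2.2 he.1

lemma inducedWeight_eq_zero [Fintype V] {D : Set V} {w : Sym2 V → ZMod 2}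
    (h : ∀ x ∈ D, ∀ y ∈ D, G.Adj x y → w s(x, y) = 0) : G.inducedWeight D w = 0 := by
  rw [inducedWeight_congr (w' := 0) (by simpa using h)]
  simp [inducedWeight]

lemma inducedWeight_coboundary [Fintype V] {D : Set V} (hD : IsInducedCycle G D)
    (p : V → ZMod 2) : G.inducedWeight D (coboundary p) = 0 := by
  classical
  have h1 : G.inducedWeight D (coboundary p) =
      ∑ e ∈ Finset.univ.filter (fun e => e ∈ G.edgeSet ∧ ∀ x ∈ e, x ∈ D),
        ∑ x, if x ∈ e then p x else 0 := by
    refine Finset.sum_congr (by congr) fun e he => ?_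
    induction e using Sym2.ind with
    | _ x y =>
    simp only [Finset.mem_filter, mem_edgeSet] at he
    have hxy : x ≠ y := he.2.1.ne
    simp only [Sym2.mem_iff, ← Finset.sum_filter]
    rw [show Finset.univ.filter (fun z => z = x ∨ z = y) = {x, y} by ext; simp,
      Finset.sum_pair hxy, coboundary_mk]
  rw [h1, Finset.sum_comm]
  refine Finset.sum_eq_zero fun x _ => ?_
  rw [← Finset.sum_filter, Finset.sum_const, Finset.filter_filter, nsmul_eq_mul]
  by_cases hx : x ∈ D
  · have h2 : Finset.card {e : Sym2 V | (e ∈ G.edgeSet ∧ ∀ z ∈ e, z ∈ D) ∧ x ∈ e} = 2 := by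
      rw [← hD.2.2 ⟨x, hx⟩, ← Set.ncard_image_of_injective (f := fun y : D => s(x, (y : V)))
        _ (fun y z h => Subtype.ext (Sym2.congr_right.1 h)), ← Set.ncard_coe_finset]
      congr 1
      ext e
      induction e using Sym2.ind with
      | _ a b =>
      simp only [Finset.coe_filter, Finset.mem_univ, true_and, Set.mem_ofPred_eq, mem_edgeSet,
        Sym2.mem_iff, forall_eq_or_imp, forall_eq, Set.mem_image, mem_neighborSet, comap_adj,
        Function.Embedding.subtype_apply, Subtype.exists, Sym2.eq_iff]
      constructor
      · rintro ⟨⟨hab, ha, hb⟩, rfl | rfl⟩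
        · exact ⟨b, hb, hab, by simp⟩
        · exact ⟨a, ha, hab.symm, by simp⟩
      · rintro ⟨y, hy, hxy, ⟨rfl, rfl⟩ | ⟨rfl, rfl⟩⟩
        · exact ⟨⟨hxy, hx, hy⟩, by simp⟩
        · exact ⟨⟨hxy.symm, hy, hx⟩, by simp⟩
    rw [h2]
    simp [show (2 : ZMod 2) = 0 from rfl]
  · rw [Finset.filter_false_of_mem (fun e _ h => hx (h.1.2 x h.2))]
    simp

lemma exists_potential {w : Sym2 V → ZMod 2} {v₀ : V} (q : ∀ v, G.Walk v₀ v)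
    (h : ∀ x y (hxy : G.Adj x y), ((q x).append (.cons hxy (q y).reverse)).weight w = 0) :
    ∃ p, ∀ e ∈ G.edgeSet, w e = coboundary p e := by
  refine ⟨fun v => (q v).weight w, fun e he => ?_⟩
  induction e using Sym2.ind with
  | _ x y =>
  have := h x y (G.mem_edgeSet.1 he)
  simp only [Walk.weight_append, Walk.weight_cons, Walk.weight_reverse] at this
  rw [coboundary_mk]
  linear_combination this - CharTwo.add_self_eq_zero ((q x).weight w)
    - CharTwo.add_self_eq_zero ((q y).weight w)

/-- If edge weights together with auxiliary parameters `μ` are detected, up to coboundaries, by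
their pairing with the induced nonseparating cycles, then there are many such cycles. -/
lemma card_le_ncard_nonsepCycles [Fintype V] [Nonempty V] {T : Type*} [Fintype T]
    (φ : T → Set V → ZMod 2)
    (h : ∀ (w : Sym2 V → ZMod 2) (μ : T → ZMod 2),
      (∀ D ∈ nonsepCycles G, G.inducedWeight D w + ∑ τ, μ τ * φ τ D = 0) →
      μ = 0 ∧ ∃ p, ∀ e ∈ G.edgeSet, w e = coboundary p e) :
    G.edgeSet.ncard + Fintype.card T + 1 ≤ (nonsepCycles G).ncard + Nat.card V := by
  classical
  let ext := Function.ExtendByZero.linearMap (ZMod 2) (Subtype.val : G.edgeSet → Sym2 V)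
  have hext : ∀ (w : G.edgeSet → ZMod 2) (e : G.edgeSet), ext w e = w e := fun w e =>
    Subtype.val_injective.extend_apply w 0 e
  let Φ : ((G.edgeSet → ZMod 2) × (T → ZMod 2)) →ₗ[ZMod 2] (nonsepCycles G → ZMod 2) :=
    { toFun := fun x D => G.inducedWeight D (ext x.1) + ∑ τ, x.2 τ * φ τ D
      map_add' := fun x y => by
        funext D
        simp only [inducedWeight, Prod.fst_add, Prod.snd_add, map_add, Pi.add_apply, add_mul,
          Finset.sum_add_distrib]
        ring
      map_smul' := fun c x => by
        funext D
        simp only [inducedWeight, Prod.smul_fst, Prod.smul_snd, map_smul, Pi.smul_apply,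
          smul_eq_mul, RingHom.id_apply, mul_add, Finset.mul_sum, mul_assoc] }
  let δ : (V → ZMod 2) →ₗ[ZMod 2] ((G.edgeSet → ZMod 2) × (T → ZMod 2)) :=
    { toFun := fun p => (fun e => coboundary p e, 0)
      map_add' := fun p q => by
        refine Prod.ext (funext fun ⟨e, he⟩ => ?_) (by simp)
        induction e using Sym2.ind with
        | _ x y => simp; ring
      map_smul' := fun c p => by
        refine Prod.ext (funext fun ⟨e, he⟩ => ?_) (by simp)
        induction e using Sym2.ind with
        | _ x y => simp; ring }
  have hker : Φ.ker ≤ δ.range := by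
    rintro ⟨w, μ⟩ hx
    rw [LinearMap.mem_ker] at hx
    obtain ⟨rfl, p, hp⟩ := h (ext w) μ fun D hD => congrFun hx ⟨D, hD⟩
    exact ⟨p, Prod.ext (funext fun e => (hp e e.2).symm.trans (hext w e)) rfl⟩
  have hδ : 0 < Module.finrank (ZMod 2) δ.ker := by
    rw [Module.finrank_pos_iff_exists_ne_zero]
    refine ⟨⟨1, ?_⟩, fun h0 => ?_⟩
    · rw [LinearMap.mem_ker]
      refine Prod.ext (funext fun ⟨e, he⟩ => ?_) rfl
      induction e using Sym2.ind with
      | _ x y => exact CharTwo.add_self_eq_zero 1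
    · exact one_ne_zero (congrFun (congrArg Subtype.val h0) (Classical.arbitrary V))
  have h1 := Φ.finrank_range_add_finrank_ker
  have h2 := δ.finrank_range_add_finrank_ker
  have h3 := Submodule.finrank_mono hker
  have h4 := Submodule.finrank_le Φ.range
  simp only [Module.finrank_prod, Module.finrank_fintype_fun_eq_card] at h1 h2 h4
  rw [← Nat.card_coe_set_eq, ← Nat.card_coe_set_eq, Nat.card_eq_fintype_card,
    Nat.card_eq_fintype_card, Nat.card_eq_fintype_card]
  omega

end Counting

section Model

variable {G : SimpleGraph V} {ι : Type*}

/-- `β` contracts `G` onto a complete graph: its fibres are nonempty, connected and pairwise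
adjacent. -/
structure IsCompleteModel (G : SimpleGraph V) (β : V → ι) : Prop where
  surjective : Function.Surjective β
  connected : ∀ i, G.WalkConnectedOn (β ⁻¹' {i})
  adj : ∀ i j, i ≠ j → ∃ x y, β x = i ∧ β y = j ∧ G.Adj x y

/-- The indicator of the edges between the fibres over `i` and `j`. -/
noncomputable def crossWeight (β : V → ι) (i j : ι) (e : Sym2 V) : ZMod 2 :=
  open Classical in if e.map β = s(i, j) then 1 else 0

lemma crossWeight_eq_zero {β : V → ι} {i j : ι} {x y : V}
    (h : ¬ ((β x = i ∧ β y = j) ∨ (β x = j ∧ β y = i))) : crossWeight β i j s(x, y) = 0 := by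
  rw [crossWeight, if_neg]
  simpa [Sym2.eq_iff] using h

lemma crossWeight_eq_one {β : V → ι} {i j : ι} {x y : V}
    (h : (β x = i ∧ β y = j) ∨ (β x = j ∧ β y = i)) : crossWeight β i j s(x, y) = 1 := by
  rw [crossWeight, if_pos]
  simpa [Sym2.eq_iff] using h

lemma inducedWeight_crossWeight_eq_zero [Fintype V] {β : V → ι} {τ : Finset ι} (hτ : τ.card = 3)
    {i j l : ι} (hi : i ∈ τ) (hj : j ∈ τ) (hl : l ∈ τ) (hij : i ≠ j) {D : Set V}
    (hD : IsInducedCycle G D) (hDτ : ∀ x ∈ D, β x ∈ τ) (hDl : ∀ x ∈ D, β x ≠ l) :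
    G.inducedWeight D (crossWeight β i j) = 0 := by
  classical
  by_cases hl' : l = i ∨ l = j
  · refine inducedWeight_eq_zero fun x hx y hy _ => crossWeight_eq_zero ?_
    have := hDl x hx
    have := hDl y hy
    grind
  · push Not at hl'
    have hτ' : ∀ t ∈ τ, t = i ∨ t = j ∨ t = l := by
      have : ({i, j, l} : Finset ι) = τ := by
        refine Finset.eq_of_subset_of_card_le (by grind) ?_
        rw [hτ, Finset.card_eq_three.2 ⟨i, j, l, hij, hl'.1.symm, hl'.2.symm, rfl⟩]
      rw [← this]
      simp
    have hD' : ∀ x ∈ D, β x = i ∨ β x = j := fun x hx => by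
      have := hτ' _ (hDτ x hx)
      have := hDl x hx
      tauto
    rw [← inducedWeight_coboundary hD fun x => if β x = i then 1 else 0]
    refine inducedWeight_congr fun x hx y hy _ => ?_
    rw [coboundary_mk]
    rcases hD' x hx with h | h <;> rcases hD' y hy with h' | h'
    · rw [crossWeight_eq_zero (by grind), if_pos h, if_pos h', CharTwo.add_self_eq_zero]
    · rw [crossWeight_eq_one (by grind), if_pos h, if_neg (by grind), add_zero]
    · rw [crossWeight_eq_one (by grind), if_neg (by grind), if_pos h', zero_add]
    · rw [crossWeight_eq_zero (by grind), if_neg (by grind), if_neg (by grind), add_zero]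

namespace IsCompleteModel

variable {β : V → ι}

lemma connected_preimage (hβ : IsCompleteModel G β) (I : Set ι) :
    G.WalkConnectedOn (β ⁻¹' I) := by
  intro x hx y hy
  have hfib : ∀ z ∈ β ⁻¹' I, ∀ t, β t = β z → t ∈ β ⁻¹' I := fun z hz t h => by
    simpa [h] using hz
  by_cases hxy : β x = β y
  · obtain ⟨p, hp⟩ := hβ.connected (β y) x hxy y rfl
    exact ⟨p, fun z hz => hfib y hy z (hp z hz)⟩
  · obtain ⟨a, b, ha, hb, hab⟩ := hβ.adj _ _ hxy
    obtain ⟨p, hp⟩ := hβ.connected (β x) x rfl a ha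
    obtain ⟨q, hq⟩ := hβ.connected (β y) b hb y rfl
    refine ⟨p.append (.cons hab q), fun z hz => ?_⟩
    simp only [Walk.mem_support_append_iff, Walk.support_cons, List.mem_cons] at hz
    rcases hz with hz | rfl | hz
    exacts [hfib x hx z (hp z hz), hfib x hx _ ha, hfib y hy z (hq z hz)]

lemma not_balancedOn_crossWeight (hβ : IsCompleteModel G β) {I : Set ι} {i j l : ι}
    (hi : i ∈ I) (hj : j ∈ I) (hl : l ∈ I) (hij : i ≠ j) (hil : i ≠ l) (hjl : j ≠ l) :
    ¬ G.BalancedOn (crossWeight β i j) (β ⁻¹' I) := by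
  intro hB
  obtain ⟨x₁, y₁, hx₁, hy₁, h₁⟩ := hβ.adj i j hij
  obtain ⟨x₂, y₂, hx₂, hy₂, h₂⟩ := hβ.adj j l hjl
  obtain ⟨x₃, y₃, hx₃, hy₃, h₃⟩ := hβ.adj l i hil.symm
  obtain ⟨p, hp⟩ := hβ.connected j y₁ hy₁ x₂ hx₂
  obtain ⟨q, hq⟩ := hβ.connected l y₂ hy₂ x₃ hx₃
  obtain ⟨r, hr⟩ := hβ.connected i y₃ hy₃ x₁ hx₁
  have hw : ∀ {c : ι} {x y : V} (p : G.Walk x y), (∀ z ∈ p.support, z ∈ β ⁻¹' {c}) →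
      p.weight (crossWeight β i j) = 0 := fun {c} _ _ p hp =>
    p.weight_eq_zero hp fun x hx y hy => crossWeight_eq_zero (by
      rw [Set.mem_preimage, Set.mem_singleton_iff] at hx hy
      grind)
  have := hB x₁ (.cons h₁ (p.append (.cons h₂ (q.append (.cons h₃ r))))) (fun z hz => by
    simp only [Walk.mem_support_append_iff, Walk.support_cons, List.mem_cons] at hz
    rw [Set.mem_preimage]
    rcases hz with rfl | hz | rfl | hz | rfl | hz
    · rwa [hx₁]
    · rwa [show β z = j from hp z hz]
    · rwa [hx₂]
    · rwa [show β z = l from hq z hz]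
    · rwa [hx₃]
    · rwa [show β z = i from hr z hz])
  simp only [Walk.weight_cons, Walk.weight_append, hw p hp, hw q hq, hw r hr] at this
  rw [crossWeight_eq_one (Or.inl ⟨hx₁, hy₁⟩), crossWeight_eq_zero (by grind),
    crossWeight_eq_zero (by grind)] at this
  simp at this

/-- A 3-connected graph contracting onto a complete graph with at least four vertices has many
induced nonseparating cycles. -/
theorem card_le_ncard_nonsepCycles [Fintype V] [Fintype ι] (hβ : IsCompleteModel G β)
    (hG : ThreeConnected G) (hι : 4 ≤ Fintype.card ι) :
    G.edgeSet.ncard + (Fintype.card ι - 1).choose 3 + 1 ≤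
      (nonsepCycles G).ncard + Nat.card V := by
  classical
  have hmissing : ∀ τ : Finset ι, τ.card ≤ 3 → ∃ l, l ∉ τ := fun τ hτ => by
    by_contra! h
    rw [Finset.eq_univ_iff_forall.2 h, Finset.card_univ] at hτ
    omega
  have hbal : ∀ (τ : Finset ι) (w : Sym2 V → ZMod 2), τ.card ≤ 3 →
      (∀ D ∈ nonsepCycles G, (∀ x ∈ D, β x ∈ τ) → G.inducedWeight D w = 0) →
      G.BalancedOn w (β ⁻¹' τ) := fun τ w hτ hw => by
    obtain ⟨l, hl⟩ := hmissing τ hτ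
    obtain ⟨v, rfl⟩ := hβ.surjective l
    have := balancedOn_compl_of_nonsepCycles hG (w := w) (B := β ⁻¹' (↑τ)ᶜ) ⟨v, hl⟩
      (hβ.connected_preimage _) fun D hD hDτ => hw D hD fun x hx => by
        by_contra h
        exact Set.disjoint_left.1 hDτ hx h
    simpa using this
  obtain ⟨o⟩ : Nonempty ι := Fintype.card_pos_iff.1 (by omega)
  obtain ⟨v₀, hv₀⟩ := hβ.surjective o
  have : Nonempty V := ⟨v₀⟩
  have hpair : ∀ τ : Finset.powersetCard 3 (Finset.univ.erase o), ∃ i j l : ι,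
      i ≠ j ∧ i ≠ l ∧ j ≠ l ∧ (τ : Finset ι) = {i, j, l} := fun τ =>
    Finset.card_eq_three.1 (Finset.mem_powersetCard.1 τ.2).2
  choose i j l hij hil hjl hτ using hpair
  have hcard : Fintype.card (Finset.powersetCard 3 (Finset.univ.erase o)) =
      (Fintype.card ι - 1).choose 3 := by
    rw [Fintype.card_coe, Finset.card_powersetCard, Finset.card_erase_of_mem (Finset.mem_univ o),
      Finset.card_univ]
  rw [← hcard]
  have hcard3 : ∀ τ : Finset.powersetCard 3 (Finset.univ.erase o), (τ : Finset ι).card = 3 :=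
    fun τ => (Finset.mem_powersetCard.1 τ.2).2
  have ho : ∀ τ : Finset.powersetCard 3 (Finset.univ.erase o), o ∉ (τ : Finset ι) := fun τ h => by
    simpa using (Finset.mem_powersetCard.1 τ.2).1 h
  let φ : Finset.powersetCard 3 (Finset.univ.erase o) → Set V → ZMod 2 := fun τ D =>
    if ∀ x ∈ D, β x ∈ (τ : Finset ι) then G.inducedWeight D (crossWeight β (i τ) (j τ)) else 0
  have hφ : ∀ (τ : Finset.powersetCard 3 (Finset.univ.erase o)) (D : Set V),
      D ∈ nonsepCycles G → (∃ t ∈ (τ : Finset ι), ∀ x ∈ D, β x ≠ t) → φ τ D = 0 := by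
    rintro τ D hD ⟨t, ht, hDt⟩
    by_cases hDτ : ∀ x ∈ D, β x ∈ (τ : Finset ι)
    · rw [show φ τ D = _ from if_pos hDτ]
      exact inducedWeight_crossWeight_eq_zero (hcard3 τ) (by simp [hτ]) (by simp [hτ]) ht (hij τ)
        hD.1 hDτ hDt
    · exact if_neg hDτ
  refine SimpleGraph.card_le_ncard_nonsepCycles φ fun w μ hwμ => ?_
  have hpot : ∃ p, ∀ e ∈ G.edgeSet, w e = coboundary p e := by
    have hwalk : ∀ v, ∃ q : G.Walk v₀ v, ∀ z ∈ q.support, β z = o ∨ β z = β v := fun v =>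
      hβ.connected_preimage {o, β v} v₀ (by simp [hv₀]) v (by simp)
    choose q hq using hwalk
    refine exists_potential q fun x y hxy => ?_
    refine hbal {o, β x, β y} w Finset.card_le_three (fun D hD hDτ => ?_) v₀ _ fun z hz => ?_
    · have := hwμ D hD
      rwa [Finset.sum_eq_zero, add_zero] at this
      intro τ _
      rw [hφ τ D hD, mul_zero]
      by_contra! h
      have hsub : (τ : Finset ι) ⊆ {β x, β y} := fun t ht => by
        obtain ⟨z, hz, rfl⟩ := h t ht
        have := hDτ z hz
        have := ho τ
        grind
      have := Finset.card_le_card hsub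
      have := Finset.card_le_two (a := β x) (b := β y)
      have := hcard3 τ
      omega
    · simp only [Walk.mem_support_append_iff, Walk.support_cons, Walk.support_reverse,
        List.mem_cons, List.mem_reverse] at hz
      simp only [Finset.coe_insert, Finset.coe_singleton, Set.mem_preimage, Set.mem_insert_iff,
        Set.mem_singleton_iff]
      rcases hz with hz | rfl | hz
      · exact (hq x z hz).imp id Or.inl
      · simp
      · exact (hq y z hz).imp id Or.inr
  refine ⟨funext fun σ => ?_, hpot⟩
  obtain ⟨p, hp⟩ := hpot
  by_contra hμ
  refine hβ.not_balancedOn_crossWeight (I := ↑(σ : Finset ι)) (by simp [hτ σ]) (by simp [hτ σ])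
    (by simp [hτ σ]) (hij σ) (hil σ) (hjl σ) (hbal _ _ (hcard3 σ).le fun D hD hDσ => ?_)
  have h0 := hwμ D hD
  rw [inducedWeight_congr (w' := coboundary p) (fun x _ y _ hxy => hp s(x, y) hxy),
    inducedWeight_coboundary hD.1, zero_add, Finset.sum_eq_single σ] at h0
  · rw [show φ σ D = _ from if_pos hDσ] at h0
    exact (mul_eq_zero.1 h0).resolve_left hμ
  · intro τ _ hτσ
    rw [hφ τ D hD, mul_zero]
    by_contra! h
    have hsub : (τ : Finset ι) ⊆ σ := fun t ht => by
      obtain ⟨z, hz, rfl⟩ := h t ht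
      exact hDσ z hz
    exact hτσ (Subtype.ext (Finset.eq_of_subset_of_card_le hsub (by rw [hcard3, hcard3])))
  · simp

end IsCompleteModel

/-- The cycle rank of a 3-connected graph is at most its number of induced nonseparating cycles. -/
theorem cycleRank_le_ncard_nonsepCycles [Fintype V] (hG : ThreeConnected G) :
    G.edgeSet.ncard + 1 ≤ (nonsepCycles G).ncard + Nat.card V := by
  have hconn : G.WalkConnectedOn Set.univ := by
    have := (hG ∅ (by simp)).preconnected.walkConnectedOn
    rwa [Set.compl_empty] at this
  obtain ⟨⟨v₀, -⟩⟩ := (hG ∅ (by simp)).nonempty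
  have : Nonempty V := ⟨v₀⟩
  refine card_le_ncard_nonsepCycles (T := Fin 0) (fun _ _ => 0) fun w μ hw =>
    ⟨Subsingleton.elim _ _, ?_⟩
  choose q hq using fun v => hconn v₀ trivial v trivial
  exact exists_potential q fun x y hxy =>
    balancedOn_univ_of_nonsepCycles hG (fun D hD => by simpa using hw D hD) _ _ fun _ _ => trivial

end Model

end SimpleGraph
namespace SimpleGraph

section CliqueModel

variable {G : SimpleGraph V}

/-- A family of nonempty, connected, pairwise disjoint and pairwise adjacent vertex sets. -/
structure IsCliqueModel (G : SimpleGraph V) (𝓑 : Finset (Set V)) : Prop where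
  nonempty : ∀ B ∈ 𝓑, B.Nonempty
  connected : ∀ B ∈ 𝓑, G.WalkConnectedOn B
  disjoint : ∀ B ∈ 𝓑, ∀ C ∈ 𝓑, B ≠ C → Disjoint B C
  adj : ∀ B ∈ 𝓑, ∀ C ∈ 𝓑, B ≠ C → ∃ x ∈ B, ∃ y ∈ C, G.Adj x y

namespace IsCliqueModel

lemma insert [DecidableEq (Set V)] {𝓑 : Finset (Set V)} (h : IsCliqueModel G 𝓑) {A : Set V}
    (hne : A.Nonempty) (hconn : G.WalkConnectedOn A) (hdisj : ∀ B ∈ 𝓑, Disjoint A B)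
    (hadj : ∀ B ∈ 𝓑, ∃ x ∈ A, ∃ y ∈ B, G.Adj x y) :
    IsCliqueModel G (insert A 𝓑) ∧ (insert A 𝓑).card = 𝓑.card + 1 := by
  refine ⟨⟨?_, ?_, ?_, ?_⟩, Finset.card_insert_of_notMem fun hA => ?_⟩
  · simpa using ⟨hne, h.nonempty⟩
  · simpa using ⟨hconn, h.connected⟩
  · intro B hB C hC hBC
    rw [Finset.mem_insert] at hB hC
    rcases hB with rfl | hB <;> rcases hC with rfl | hC
    exacts [absurd rfl hBC, hdisj C hC, (hdisj B hB).symm, h.disjoint B hB C hC hBC]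
  · intro B hB C hC hBC
    rw [Finset.mem_insert] at hB hC
    rcases hB with rfl | hB <;> rcases hC with rfl | hC
    · exact absurd rfl hBC
    · exact hadj C hC
    · obtain ⟨x, hx, y, hy, hxy⟩ := hadj B hB
      exact ⟨y, hy, x, hx, hxy.symm⟩
    · exact h.adj B hB C hC hBC
  · exact hne.ne_empty (disjoint_self.1 (hdisj A hA))

lemma of_isClique [DecidableEq (Set V)] {K : Finset V} (hK : G.IsClique K) :
    IsCliqueModel G (K.image fun x => {x}) where
  nonempty := by simp
  connected := by
    simp only [Finset.forall_mem_image]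
    rintro x - y rfl z rfl
    exact ⟨Walk.nil, by simp⟩
  disjoint := by
    simp only [Finset.forall_mem_image]
    intro x _ y _ h
    simpa using fun hxy => h (by rw [hxy])
  adj := by
    simp only [Finset.forall_mem_image]
    intro x hx y hy h
    exact ⟨x, rfl, y, rfl, hK hx hy fun hxy => h (by rw [hxy])⟩

/-- A clique model in a connected graph extends to one covering all the vertices. -/
lemma exists_isCompleteModel [Finite V] {𝓑 : Finset (Set V)} (h : IsCliqueModel G 𝓑)
    (hne : 𝓑.Nonempty) (hG : G.Preconnected) : ∃ β : V → 𝓑, IsCompleteModel G β := by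
  obtain ⟨F, hF, hmax⟩ := Finite.exists_le_maximal
    (p := fun F : 𝓑 → Set V => (∀ i, G.WalkConnectedOn (F i)) ∧
      ∀ i j, i ≠ j → Disjoint (F i) (F j))
    (a := fun B => B.1) ⟨fun i => h.connected i i.2, fun i j hij =>
      h.disjoint i i.2 j j.2 fun h => hij (Subtype.ext h)⟩
  have hcover : ∀ v, ∃ i, v ∈ F i := by
    classical
    by_contra! hv
    obtain ⟨v, hv⟩ := hv
    obtain ⟨B, hB⟩ := hne
    obtain ⟨b, hb⟩ := h.nonempty B hB
    obtain ⟨p⟩ := hG b v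
    obtain ⟨d, -, hd₁, hd₂⟩ := p.exists_boundary_dart (⋃ i, F i)
      (Set.mem_iUnion.2 ⟨⟨B, hB⟩, hF ⟨B, hB⟩ hb⟩) (by simpa using hv)
    obtain ⟨i, hi⟩ := Set.mem_iUnion.1 hd₁
    have hd₂' : ∀ j, d.snd ∉ F j := by simpa using hd₂
    have hle : F ≤ Function.update F i (Insert.insert d.snd (F i)) := by
      intro j
      rcases eq_or_ne j i with rfl | hj
      · rw [Function.update_self]; exact Set.subset_insert _ _
      · rw [Function.update_of_ne hj]
    have hge := hmax.le_of_ge (y := Function.update F i (Insert.insert d.snd (F i)))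
      ⟨fun j => ?_, fun j k hjk => ?_⟩ hle i
    · rw [Function.update_self] at hge
      exact hd₂' i (hge (Set.mem_insert _ _))
    · rcases eq_or_ne j i with rfl | hj
      · rw [Function.update_self]
        exact (hmax.prop.1 j).insert hi d.adj
      · rw [Function.update_of_ne hj]
        exact hmax.prop.1 j
    · have := hmax.prop.2 j k hjk
      rcases eq_or_ne j i with rfl | hj
      · rw [Function.update_self, Function.update_of_ne hjk.symm]
        exact Set.disjoint_insert_left.2 ⟨hd₂' k, this⟩
      · rw [Function.update_of_ne hj]
        rcases eq_or_ne k i with rfl | hk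
        · rw [Function.update_self]
          exact Set.disjoint_insert_right.2 ⟨hd₂' j, this⟩
        · rwa [Function.update_of_ne hk]
  choose β hβ using hcover
  have hfib : ∀ {v i}, v ∈ F i → β v = i := fun {v i} hv => by
    by_contra hne
    exact Set.disjoint_left.1 (hmax.prop.2 _ _ hne) (hβ v) hv
  refine ⟨β, ⟨fun i => ?_, fun i => ?_, fun i j hij => ?_⟩⟩
  · obtain ⟨b, hb⟩ := h.nonempty i i.2
    exact ⟨b, hfib (hF i hb)⟩
  · rw [show β ⁻¹' {i} = F i from Set.ext fun v => ⟨fun hv => (show β v = i from hv) ▸ hβ v, hfib⟩]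
    exact hmax.prop.1 i
  · obtain ⟨x, hx, y, hy, hxy⟩ := h.adj i i.2 j j.2 fun h => hij (Subtype.ext h)
    exact ⟨x, y, hfib (hF i hx), hfib (hF j hy), hxy⟩

end IsCliqueModel

lemma walkConnectedOn_star {v : V} {S : Set V} (h : ∀ y ∈ S, G.Adj v y) :
    G.WalkConnectedOn (insert v S) := by
  have key : ∀ y ∈ Insert.insert v S, ∃ p : G.Walk v y, ∀ z ∈ p.support,
      z ∈ Insert.insert v S := by
    rintro y (rfl | hy)
    · exact ⟨Walk.nil, by simp⟩
    · exact ⟨Walk.cons (h y hy) Walk.nil, by simp [hy]⟩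
  intro x hx y hy
  obtain ⟨p, hp⟩ := key x hx
  obtain ⟨q, hq⟩ := key y hy
  refine ⟨p.reverse.append q, fun z hz => ?_⟩
  rw [Walk.mem_support_append_iff, Walk.support_reverse, List.mem_reverse] at hz
  exact hz.elim (hp z) (hq z)

end CliqueModel

end SimpleGraph

namespace IsOverDominating

variable {G : SimpleGraph V} {k : ℕ} {f : V → Fin k}

/-- Three colour classes of an over-dominating colouring contain a triangle. -/
lemma exists_triangle (hf : IsOverDominating G f) {I : Finset (Fin k)} (hI : I.card = 3) :
    ∃ K : Finset V, G.IsClique K ∧ K.card = 3 ∧ ∀ x ∈ K, f x ∈ I := by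
  classical
  obtain ⟨hprop, -, hnbr, hdom⟩ := hf
  obtain ⟨i, j, l, hij, hil, hjl, rfl⟩ := Finset.card_eq_three.1 hI
  have key : ∀ i j : Fin k, i ≠ l → j ≠ l → i ≠ j →
      (∃ x, f x = i ∧ ∀ y, f y = j → G.Adj x y) →
      ∃ x y z, G.Adj x y ∧ G.Adj x z ∧ G.Adj y z ∧ f x = i ∧ f y = l ∧ f z = j := by
    rintro i j hil hjl hij ⟨x, rfl, hx⟩
    obtain ⟨y, hxy, hy⟩ := hnbr x l hil.symm
    obtain ⟨z, hyz, hz⟩ := hnbr y j (by rwa [hy])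
    exact ⟨x, y, z, hxy, hx z hz, hyz, rfl, hy, hz⟩
  have fin : ∀ x y z, G.Adj x y ∧ G.Adj x z ∧ G.Adj y z →
      (∀ t ∈ ({x, y, z} : Finset V), f t ∈ ({i, j, l} : Finset (Fin k))) →
      ∃ K : Finset V, G.IsClique K ∧ K.card = 3 ∧
        ∀ x ∈ K, f x ∈ ({i, j, l} : Finset (Fin k)) := fun x y z h ht => by
    have := is3Clique_triple_iff.2 h
    exact ⟨_, this.isClique, this.card_eq, ht⟩
  rcases hdom i j hij with h | h
  · obtain ⟨x, y, z, h1, h2, h3, hx, hy, hz⟩ := key i j hil hjl hij h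
    exact fin x y z ⟨h1, h2, h3⟩ (by simp [hx, hy, hz])
  · obtain ⟨x, y, z, h1, h2, h3, hx, hy, hz⟩ := key j i hjl hil hij.symm h
    exact fin x y z ⟨h1, h2, h3⟩ (by simp [hx, hy, hz])

/-- If no colour class has distinct vertices dominating distinct classes, then there is a clique
meeting every class. -/
lemma exists_clique (hf : IsOverDominating G f) (I : Finset (Fin k))
    (hI : ∀ i ∈ I, ∀ j ∈ I, ∀ l ∈ I, i ≠ j → i ≠ l → j ≠ l → ∀ u v, f u = i → f v = i →
      (∀ y, f y = j → G.Adj u y) → (∀ y, f y = l → G.Adj v y) → u = v) :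
    ∃ K : Finset V, G.IsClique K ∧ K.card = I.card ∧ ∀ x ∈ K, f x ∈ I := by
  classical
  obtain ⟨hprop, hsurj, hnbr, hdom⟩ := hf
  have hx : ∀ i, ∃ x, f x = i ∧ (i ∈ I → ∀ j ∈ I, i ≠ j →
      (∃ v, f v = i ∧ ∀ y, f y = j → G.Adj v y) → ∀ y, f y = j → G.Adj x y) := by
    intro i
    by_cases h : ∃ j ∈ I, i ≠ j ∧ ∃ v, f v = i ∧ ∀ y, f y = j → G.Adj v y
    · obtain ⟨j, hj, hij, x, hx, hxj⟩ := h
      refine ⟨x, hx, fun hi l hl hil ⟨v, hv, hvl⟩ => ?_⟩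
      rcases eq_or_ne j l with rfl | hjl
      · exact hxj
      · rwa [hI i hi j hj l hl hij hil hjl x v hx hv hxj hvl]
    · obtain ⟨x, hx⟩ := hsurj i
      exact ⟨x, hx, fun _ j hj hij hv => absurd ⟨j, hj, hij, hv⟩ h⟩
  choose x hx hdomx using hx
  refine ⟨I.image x, ?_, Finset.card_image_of_injective _ fun i j h => by rw [← hx i, h, hx],
    by simp [hx]⟩
  rw [Finset.coe_image]
  rintro _ ⟨i, hi, rfl⟩ _ ⟨j, hj, rfl⟩ hne
  have hij : i ≠ j := fun h => hne (by rw [h])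
  rcases hdom i j hij with h | h
  · exact hdomx i hi j hj hij h _ (hx j)
  · exact (hdomx j hj i hi hij.symm h _ (hx i)).symm

/-- The colour classes in `I` contain a clique model with more than `⌊2|I|/3⌋` sets. -/
theorem exists_isCliqueModel (hf : IsOverDominating G f) (I : Finset (Fin k)) (hne : I.Nonempty) :
    ∃ 𝓑, IsCliqueModel G 𝓑 ∧ 2 * I.card / 3 + 1 ≤ 𝓑.card ∧ ∀ B ∈ 𝓑, ∀ x ∈ B, f x ∈ I := by
  classical
  induction hn : I.card using Nat.strong_induction_on generalizing I with
  | _ n ih =>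
  subst hn
  have of_clique : ∀ K : Finset V, G.IsClique K → 2 * I.card / 3 + 1 ≤ K.card →
      (∀ x ∈ K, f x ∈ I) →
      ∃ 𝓑, IsCliqueModel G 𝓑 ∧ 2 * I.card / 3 + 1 ≤ 𝓑.card ∧ ∀ B ∈ 𝓑, ∀ x ∈ B, f x ∈ I :=
    fun K hK hcard hKI => ⟨_, IsCliqueModel.of_isClique hK, by
      rwa [Finset.card_image_of_injective _ Set.singleton_injective], by simpa using hKI⟩
  by_cases h3 : I.card = 3
  · obtain ⟨K, hK, hcard, hKI⟩ := hf.exists_triangle h3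
    exact of_clique K hK (by omega) hKI
  by_cases hI : ∀ i ∈ I, ∀ j ∈ I, ∀ l ∈ I, i ≠ j → i ≠ l → j ≠ l → ∀ u v, f u = i → f v = i →
      (∀ y, f y = j → G.Adj u y) → (∀ y, f y = l → G.Adj v y) → u = v
  · obtain ⟨K, hK, hcard, hKI⟩ := hf.exists_clique I hI
    have := hne.card_pos
    exact of_clique K hK (by omega) hKI
  push Not at hI
  obtain ⟨i, hi, j, hj, l, hl, hij, hil, hjl, u, v, hu, hv, huj, hvl, huv⟩ := hI
  have hsub : ({i, j, l} : Finset (Fin k)) ⊆ I := by simp [Finset.insert_subset_iff, hi, hj, hl]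
  have hcard3 : ({i, j, l} : Finset (Fin k)).card = 3 :=
    Finset.card_eq_three.2 ⟨i, j, l, hij, hil, hjl, rfl⟩
  have hcard := Finset.card_sdiff_of_subset hsub
  have hle := Finset.card_le_card hsub
  have hIcard : (I \ {i, j, l}).card + 3 = I.card := by omega
  obtain ⟨𝓑, h𝓑, h𝓑card, h𝓑I⟩ := ih (I \ {i, j, l}).card (by omega) (I \ {i, j, l})
    (Finset.card_pos.1 (by omega)) rfl
  have h𝓑f : ∀ B ∈ 𝓑, ∀ x ∈ B, f x ∈ I ∧ f x ≠ i ∧ f x ≠ j ∧ f x ≠ l := fun B hB x hx => by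
    simpa using h𝓑I B hB x hx
  obtain ⟨-, hsurj, hnbr, -⟩ := hf
  have hnbr' : ∀ {c : Fin k} {t : V} {B : Set V}, (∃ x ∈ B, f x ≠ c) →
      ∃ x ∈ insert t {y | f y = c}, ∃ y ∈ B, G.Adj x y := by
    rintro c t B ⟨x, hx, hxc⟩
    obtain ⟨y, hxy, hy⟩ := hnbr x c hxc.symm
    exact ⟨y, Or.inr hy, x, hx, hxy.symm⟩
  obtain ⟨h𝓒, h𝓒card⟩ := h𝓑.insert (A := insert u {y | f y = j}) (Set.insert_nonempty _ _)
    (walkConnectedOn_star huj)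
    (fun B hB => Set.disjoint_left.2 fun x hx hxB => by
      have := h𝓑f B hB x hxB
      rcases hx with rfl | hx
      exacts [this.2.1 hu, this.2.2.1 hx])
    (fun B hB => by
      obtain ⟨x, hx⟩ := h𝓑.nonempty B hB
      exact hnbr' ⟨x, hx, (h𝓑f B hB x hx).2.2.1⟩)
  obtain ⟨h𝓓, h𝓓card⟩ := h𝓒.insert (A := insert v {y | f y = l}) (Set.insert_nonempty _ _)
    (walkConnectedOn_star hvl)
    (fun B hB => Set.disjoint_left.2 fun x hx hxB => by
      rw [Finset.mem_insert] at hB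
      rcases hB with rfl | hB
      · rcases hx with rfl | hx <;> rcases hxB with rfl | hxB
        · exact huv rfl
        · exact hij (hv.symm.trans hxB)
        · exact hil (hu.symm.trans hx)
        · exact hjl (Eq.trans (Eq.symm hxB) hx)
      · have := h𝓑f B hB x hxB
        rcases hx with rfl | hx
        exacts [this.2.1 hv, this.2.2.2 hx])
    (fun B hB => by
      rw [Finset.mem_insert] at hB
      rcases hB with rfl | hB
      · exact hnbr' ⟨u, Set.mem_insert _ _, by rwa [hu]⟩
      · obtain ⟨x, hx⟩ := h𝓑.nonempty B hB
        exact hnbr' ⟨x, hx, (h𝓑f B hB x hx).2.2.2⟩)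
  refine ⟨_, h𝓓, by omega, fun B hB x hx => ?_⟩
  simp only [Finset.mem_insert] at hB
  rcases hB with rfl | rfl | hB
  · rcases hx with rfl | hx
    exacts [hv ▸ hi, (show f x = l from hx) ▸ hl]
  · rcases hx with rfl | hx
    exacts [hu ▸ hi, (show f x = j from hx) ▸ hj]
  · exact (h𝓑f B hB x hx).1

end IsOverDominating

lemma cast_choose_three (m : ℕ) :
    ((m.choose 3 : ℕ) : ℚ) = 1 / 6 * (m : ℚ) ^ 3 - 1 / 2 * (m : ℚ) ^ 2 + 1 / 3 * (m : ℚ) := by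
  induction m with
  | zero => simp
  | succ m ih =>
    rw [Nat.choose_succ_succ', Nat.cast_add, ih, Nat.cast_choose_two]
    push_cast
    ring

/-- If a finite simple 3-connected graph `G` admits an over-dominating
`k`-colouring, then
`|E(G)| - |V(G)| + (1/6)⌊2k/3⌋³ - (1/2)⌊2k/3⌋² + (1/3)⌊2k/3⌋ + 1 ≤ |C(G)|`. -/
theorem stmt2 [Finite V] (G : SimpleGraph V) (hG : ThreeConnected G)
    {k : ℕ} (f : V → Fin k) (hf : IsOverDominating G f) :
    (G.edgeSet.ncard : ℚ) - (Nat.card V : ℚ)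
        + (1 / 6) * ((2 * k / 3 : ℕ) : ℚ) ^ 3 - (1 / 2) * ((2 * k / 3 : ℕ) : ℚ) ^ 2
        + (1 / 3) * ((2 * k / 3 : ℕ) : ℚ) + 1
      ≤ ((nonsepCycles G).ncard : ℚ) := by
  classical
  have := Fintype.ofFinite V
  have hconn := hG ∅ (by simp)
  obtain ⟨⟨v₀, -⟩⟩ := hconn.nonempty
  have hpre : G.Preconnected := fun x y => by
    obtain ⟨p, -⟩ := hconn.preconnected.walkConnectedOn x (by simp) y (by simp)
    exact ⟨p⟩
  have key : G.edgeSet.ncard + (2 * k / 3).choose 3 + 1 ≤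
      (nonsepCycles G).ncard + Nat.card V := by
    rcases lt_or_ge (2 * k / 3) 3 with hk | hk
    · rw [Nat.choose_eq_zero_of_lt hk]
      exact cycleRank_le_ncard_nonsepCycles hG
    · obtain ⟨𝓑, h𝓑, hcard, -⟩ := hf.exists_isCliqueModel Finset.univ ⟨f v₀, Finset.mem_univ _⟩
      rw [Finset.card_univ, Fintype.card_fin] at hcard
      obtain ⟨β, hβ⟩ := h𝓑.exists_isCompleteModel (Finset.card_pos.1 (by omega)) hpre
      have := hβ.card_le_ncard_nonsepCycles hG (by rw [Fintype.card_coe]; omega)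
      rw [Fintype.card_coe] at this
      have := Nat.choose_le_choose 3 (show 2 * k / 3 ≤ 𝓑.card - 1 by omega)
      omega
  have hq : (G.edgeSet.ncard : ℚ) + ((2 * k / 3).choose 3 : ℕ) + 1 ≤
      (nonsepCycles G).ncard + Nat.card V := by exact_mod_cast key
  rw [cast_choose_three] at hq
  linarith
end

section
/- Let G be a finite simple 3-connected graph and suppose G = G₁ ⊕_T G₂ is a clique-sum of two graphs G₁ and G₂ along a triangle T (so T separates G, and G₁, G₂ are the subgraphs induced on V(T) together with the respective sides). Then (C(G₁) \ {T}) ∪ (C(G₂) \ {T}) ⊆ C(G), and moreover the two sets C(G₁) \ {T} and C(G₂) \ {T} are disjoint, where C(H) denotes the set of induced nonseparating cycles of H. -/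
open SimpleGraph

variable {V : Type*} {W : Type*}

/-- The induced nonseparating cycles of the induced subgraph of `G` on the
vertex set `Ws`, recorded as subsets of `V`. -/
def nonsepCyclesIn (G : SimpleGraph V) (Ws : Set V) : Set (Set V) :=
  {C | C ⊆ Ws ∧ IsInducedCycle G C ∧ (G.induce (Ws \ C)).Preconnected}

/-- An induced cycle containing a triangle is that triangle. -/
theorem IsInducedCycle.eq_of_isClique_subset [Finite V] {G : SimpleGraph V} {C T : Set V}
    (hC : IsInducedCycle G C) (hT : G.IsClique T) (hT3 : T.ncard = 3) (hTC : T ⊆ C) :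
    C = T := by
  obtain ⟨-, hconn, hdeg⟩ := hC
  have closed : ∀ u v : C, (u : V) ∈ T → (G.induce C).Adj u v → (v : V) ∈ T := by
    intro u v hu huv
    have hsub : (Subtype.val ⁻¹' (T \ {(u : V)}) : Set C) ⊆ (G.induce C).neighborSet u := by
      intro w hw
      exact hT hu hw.1 (fun h => hw.2 h.symm)
    have hcard : (Subtype.val ⁻¹' (T \ {(u : V)}) : Set C).ncard = 2 := by
      rw [Set.ncard_preimage_of_injective_subset_range Subtype.val_injective
        (by rw [Subtype.range_coe]; exact Set.sdiff_subset.trans hTC),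
        Set.ncard_sdiff_singleton_of_mem hu, hT3]
    have heq := Set.eq_of_subset_of_ncard_le hsub (by rw [hcard, hdeg u])
    have hv : v ∈ (G.induce C).neighborSet u := huv
    rw [← heq] at hv
    exact hv.1
  have walk_mem : ∀ (u v : C), (G.induce C).Walk u v → (u : V) ∈ T → (v : V) ∈ T := by
    intro u v p
    induction p with
    | nil => exact id
    | cons h _ ih => exact fun hu => ih (closed _ _ hu h)
  obtain ⟨t, ht⟩ : T.Nonempty := Set.nonempty_of_ncard_ne_zero (by omega)
  refine Set.Subset.antisymm (fun v hv => ?_) hTC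
  obtain ⟨p⟩ := hconn.preconnected ⟨t, hTC ht⟩ ⟨v, hv⟩
  exact walk_mem _ _ p ht

/-- Induced nonseparating cycles of one side of a clique-sum along a triangle, other than
the triangle itself, are nonseparating in the whole 3-connected graph. -/
theorem nonsepCyclesIn_diff_subset_nonsepCycles [Finite V] {G : SimpleGraph V}
    (hG : ThreeConnected G) {T A B : Set V} (hT : G.IsClique T) (hT3 : T.ncard = 3)
    (hAB : Disjoint A B) (hUnion : A ∪ B = Tᶜ) (hsep : ∀ a ∈ A, ∀ b ∈ B, ¬ G.Adj a b) :
    nonsepCyclesIn G (A ∪ T) \ {T} ⊆ nonsepCycles G := by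
  rintro C ⟨⟨hCsub, hC, hpre⟩, hCT⟩
  refine ⟨hC, ?_⟩
  have hnot : ¬ T ⊆ C := fun h => hCT (hC.eq_of_isClique_subset hT hT3 h)
  obtain ⟨t, ht, htC⟩ := Set.not_subset.1 hnot
  have hcover : ∀ v, v ∈ A ∨ v ∈ B ∨ v ∈ T := by
    intro v
    by_cases hv : v ∈ T
    · exact Or.inr (Or.inr hv)
    · have : v ∈ A ∪ B := hUnion ▸ hv
      exact this.imp_right Or.inl
  have hBT : ∀ v ∈ B, v ∉ T := fun v hv => by
    have : v ∈ Tᶜ := hUnion ▸ Or.inr hv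
    exact this
  have hBC : ∀ v ∈ B, v ∉ C := fun v hv hvC =>
    (hCsub hvC).elim (fun h => Set.disjoint_left.1 hAB h hv) (hBT v hv)
  have hcard : (C ∩ T).ncard ≤ 2 := by
    have : (C ∩ T).ncard < T.ncard :=
      Set.ncard_lt_ncard ⟨Set.inter_subset_right, fun h => hnot fun v hv => (h hv).1⟩
    omega
  have reach_walk : ∀ u v : ((C ∩ T)ᶜ : Set V), (G.induce (C ∩ T)ᶜ).Walk u v → (v : V) = t →
      ∀ huC : (u : V) ∈ Cᶜ, (u : V) ∈ B ∪ T →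
        (G.induce Cᶜ).Reachable ⟨u, huC⟩ ⟨t, htC⟩ := by
    intro u v p
    induction p with
    | nil =>
      rintro rfl _ _
      exact Reachable.refl _
    | @cons u w v h p ih =>
      intro hvt huC hu
      rcases hu with hu | hu
      · have hadj : G.Adj u w := h
        have hw : (w : V) ∈ B ∪ T := (hcover w).resolve_left fun hwA =>
          hsep _ hwA _ hu hadj.symm
        have hwC : (w : V) ∈ Cᶜ := hw.elim (hBC _) fun hwT hwC => w.2 ⟨hwC, hwT⟩
        have huw : (G.induce Cᶜ).Adj ⟨u, huC⟩ ⟨w, hwC⟩ := hadj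
        exact huw.reachable.trans (ih hvt hwC hw)
      · by_cases hut : (u : V) = t
        · subst hut
          exact Reachable.refl _
        · have hadj : (G.induce Cᶜ).Adj ⟨u, huC⟩ ⟨t, htC⟩ := hT hu ht hut
          exact hadj.reachable
  have reach : ∀ u : (Cᶜ : Set V), (G.induce Cᶜ).Reachable u ⟨t, htC⟩ := by
    rintro ⟨u, huC⟩
    by_cases hu : u ∈ B
    · obtain ⟨p⟩ := (hG _ hcard).preconnected ⟨u, fun h => huC h.1⟩ ⟨t, fun h => htC h.1⟩
      exact reach_walk _ _ p rfl huC (Or.inl hu)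
    · have hmem : u ∈ (A ∪ T) \ C := ⟨(hcover u).imp_right (Or.resolve_left · hu), huC⟩
      exact (hpre ⟨u, hmem⟩ ⟨t, Or.inr ht, htC⟩).map
        (G.induceHomOfLE (fun _ hv => hv.2 : (A ∪ T) \ C ⊆ Cᶜ)).toHom
  exact fun u v => (reach u).trans (reach v).symm

/-- If the 3-connected graph `G` is the clique-sum `G₁ ⊕_T G₂` along a
triangle `T` (with `G₁`, `G₂` induced on `A ∪ T` and `B ∪ T`, where `A`, `B`
partition the components of `G - T`), then
`(C(G₁) \ {T}) ∪ (C(G₂) \ {T}) ⊆ C(G)`, and the two sets are disjoint. -/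
theorem stmt4 [Finite V] (G : SimpleGraph V) (hG : ThreeConnected G)
    (T A B : Set V) (hT : G.IsClique T) (hT3 : T.ncard = 3)
    (hAB : Disjoint A B) (hUnion : A ∪ B = Tᶜ) (hA : A.Nonempty) (hB : B.Nonempty)
    (hsep : ∀ a ∈ A, ∀ b ∈ B, ¬ G.Adj a b) :
    ((nonsepCyclesIn G (A ∪ T) \ {T}) ∪ (nonsepCyclesIn G (B ∪ T) \ {T})
        ⊆ nonsepCycles G) ∧
    Disjoint (nonsepCyclesIn G (A ∪ T) \ {T}) (nonsepCyclesIn G (B ∪ T) \ {T}) := by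
  refine ⟨Set.union_subset
    (nonsepCyclesIn_diff_subset_nonsepCycles hG hT hT3 hAB hUnion hsep)
    (nonsepCyclesIn_diff_subset_nonsepCycles hG hT hT3 hAB.symm
      (Set.union_comm B A ▸ hUnion) fun b hb a ha h => hsep a ha b hb h.symm), ?_⟩
  rw [Set.disjoint_left]
  rintro C ⟨⟨hCA, hC, -⟩, hCT⟩ ⟨⟨hCB, -, -⟩, -⟩
  have hsub : C ⊆ T := fun v hv => (hCA hv).elim
    (fun hvA => (hCB hv).resolve_left (Set.disjoint_left.1 hAB hvA)) id
  exact hCT (Set.eq_of_subset_of_ncard_le hsub (hT3 ▸ hC.1))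
end

section
/- Let G be a finite simple 3-connected graph, let T be a triangle in G whose deletion disconnects G, and let H be a component of G - V(T). Then the subgraph G' of G induced on V(H) ∪ V(T) is 3-connected. -/
open SimpleGraph

variable {V : Type*} {W : Type*}

/-- If `T` is a separating triangle of the 3-connected graph `G` and `H` is a
component of `G - T`, then the subgraph induced on `V(H) ∪ V(T)` is
3-connected. -/
theorem stmt7 [Finite V] (G : SimpleGraph V) (hG : ThreeConnected G)
    (T : Set V) (hT : G.IsClique T) (hT3 : T.ncard = 3)
    (hdisc : ¬ (G.induce Tᶜ).Connected)
    (H : Set V) (hHT : H ⊆ Tᶜ) (hHne : H.Nonempty) (hHconn : (G.induce H).Connected)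
    (hHcl : ∀ x ∈ H, ∀ y ∈ Tᶜ, G.Adj x y → y ∈ H) :
    ThreeConnected (G.induce (H ∪ T)) := by
  intro S hS
  have hS' : (Subtype.val '' S).ncard ≤ 2 :=
    (Set.ncard_image_le (Set.toFinite S)).trans hS
  obtain ⟨t, htT, htS⟩ : ∃ t ∈ T, t ∉ Subtype.val '' S :=
    Set.exists_mem_notMem_of_ncard_lt_ncard (by omega)
  have hmem : ∀ x (hx : x ∈ H ∪ T), x ∉ Subtype.val '' S → (⟨x, hx⟩ : ↥(H ∪ T)) ∈ Sᶜ :=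
    fun x hx hxS h => hxS ⟨_, h, rfl⟩
  have key : ∀ a b : ↥(Subtype.val '' S)ᶜ, (G.induce (Subtype.val '' S)ᶜ).Walk a b →
      b.1 = t → ∀ ha : a.1 ∈ H ∪ T,
      ((G.induce (H ∪ T)).induce Sᶜ).Reachable ⟨⟨a.1, ha⟩, hmem _ ha a.2⟩
        ⟨⟨t, Or.inr htT⟩, hmem _ _ htS⟩ := by
    intro a b p hb
    induction p with
    | nil =>
      intro ha
      subst hb
      exact Reachable.refl _
    | @cons u v w huv q ih =>
      intro ha
      rcases ha with hu | hu
      · have hv : v.1 ∈ H ∪ T := by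
          by_cases hvT : v.1 ∈ T
          · exact Or.inr hvT
          · exact Or.inl (hHcl u.1 hu v.1 hvT huv)
        have huv' : ((G.induce (H ∪ T)).induce Sᶜ).Adj ⟨⟨u.1, Or.inl hu⟩, hmem _ _ u.2⟩
            ⟨⟨v.1, hv⟩, hmem _ hv v.2⟩ := huv
        exact huv'.reachable.trans (ih hb hv)
      · by_cases hut : u.1 = t
        · subst hut
          exact Reachable.refl _
        · exact Adj.reachable (hT hu htT hut)
  refine connected_iff_exists_forall_reachable _ |>.2 ⟨⟨⟨t, Or.inr htT⟩, hmem _ _ htS⟩, ?_⟩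
  rintro ⟨⟨x, hx⟩, hxS⟩
  have hxS' : x ∉ Subtype.val '' S := by
    rintro ⟨y, hy, rfl⟩
    exact hxS hy
  obtain ⟨p⟩ := (hG _ hS').preconnected ⟨x, hxS'⟩ ⟨t, htS⟩
  exact (key _ _ p rfl hx).symm
end

section
/- Let G be a finite simple 3-connected graph, let T be a triangle in G whose deletion disconnects G, and let H be a component of G - V(T). Then the subgraph G' of G induced on V(H) ∪ V(T) satisfies h(G') ≥ 4, where h denotes the Hadwiger number; indeed, contracting H to a single vertex yields K₄ as a minor. -/
open SimpleGraph

variable {V : Type*} {W : Type*}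

/-- A vertex set closed under adjacency is closed under reachability. -/
theorem SimpleGraph.Reachable.mem_of_adj_closed {G : SimpleGraph V} {A : Set V}
    (hA : ∀ x ∈ A, ∀ y, G.Adj x y → y ∈ A) {x y : V} (h : G.Reachable x y) (hx : x ∈ A) :
    y ∈ A := by
  obtain ⟨p⟩ := h
  induction p with
  | nil => exact hx
  | cons hadj _ ih => exact ih (hA _ hx _ hadj)

/-- Connectedness of `A ⊆ S` does not depend on whether it is tested in `G` or in `G[S]`. -/
theorem SimpleGraph.Connected.induce_preimage_val {G : SimpleGraph V} {S A : Set V}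
    (hAS : A ⊆ S) (hA : (G.induce A).Connected) :
    ((G.induce S).induce (Subtype.val ⁻¹' A)).Connected := by
  let e : G.induce A ≃g (G.induce S).induce (Subtype.val ⁻¹' A) :=
    { toFun := fun x => ⟨⟨x.1, hAS x.2⟩, x.2⟩
      invFun := fun x => ⟨x.1.1, x.2⟩
      left_inv := fun _ => rfl
      right_inv := fun _ => rfl
      map_rel_iff' := Iff.rfl }
  exact e.connected_iff.mp hA

/-- A minor model whose branch sets all lie in `S` is a minor model in `G[S]`. -/
theorem isMinor_induce_of_subset {G : SimpleGraph V} {K : SimpleGraph W} {S : Set V}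
    (f : W → Set V) (hS : ∀ i, f i ⊆ S) (hconn : ∀ i, (G.induce (f i)).Connected)
    (hdisj : Pairwise fun i j => Disjoint (f i) (f j))
    (hadj : ∀ i j, K.Adj i j → ∃ a ∈ f i, ∃ b ∈ f j, G.Adj a b) :
    IsMinor K (G.induce S) := by
  refine ⟨fun i => Subtype.val ⁻¹' f i, fun i => ?_,
    fun i => (hconn i).induce_preimage_val (hS i), fun i j hij => (hdisj hij).preimage _,
    fun i j hij => ?_⟩
  · obtain ⟨x⟩ := (hconn i).nonempty
    exact ⟨⟨x.1, hS i x.2⟩, x.2⟩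
  · obtain ⟨a, ha, b, hb, hab⟩ := hadj i j hij
    exact ⟨⟨a, hS i ha⟩, ha, ⟨b, hS j hb⟩, hb, hab⟩

theorem IsMinor.card_le [Finite V] {K : SimpleGraph W} {G : SimpleGraph V} (h : IsMinor K G) :
    Nat.card W ≤ Nat.card V := by
  obtain ⟨f, hne, -, hdisj, -⟩ := h
  choose r hr using hne
  refine Nat.card_le_card_of_injective r fun i j hij => ?_
  by_contra hne
  exact Set.disjoint_left.mp (hdisj hne) (hr i) (hij ▸ hr j)

theorem IsMinor.le_hadwigerNumber [Finite V] {G : SimpleGraph V} {n : ℕ}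
    (h : IsMinor (⊤ : SimpleGraph (Fin n)) G) : n ≤ hadwigerNumber G :=
  le_csSup ⟨Nat.card V, fun m hm => by simpa using IsMinor.card_le hm⟩ h

/-- Every vertex of a separating set of three vertices in a 3-connected graph has a neighbor
in each component left after deleting that set. -/
theorem ThreeConnected.exists_adj_of_separating [Finite V] {G : SimpleGraph V}
    (hG : ThreeConnected G) {T H : Set V} (hT3 : T.ncard = 3)
    (hdisc : ¬ (G.induce Tᶜ).Connected) (hHT : H ⊆ Tᶜ) (hHconn : (G.induce H).Connected)
    (hHcl : ∀ x ∈ H, ∀ y ∈ Tᶜ, G.Adj x y → y ∈ H) {t : V} (ht : t ∈ T) :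
    ∃ x ∈ H, G.Adj x t := by
  by_contra! hno
  obtain ⟨y, hyT, hyH⟩ : ∃ y ∈ Tᶜ, y ∉ H := by
    by_contra! hsub
    exact hdisc (hHT.antisymm hsub ▸ hHconn)
  obtain ⟨x⟩ := hHconn.nonempty
  have hcard : (T \ {t}).ncard ≤ 2 := by
    rw [Set.ncard_sdiff_singleton_of_mem ht, hT3]
  have hreach := (hG _ hcard).preconnected ⟨x.1, fun h => hHT x.2 h.1⟩ ⟨y, fun h => hyT h.1⟩
  refine hyH (hreach.mem_of_adj_closed (A := Subtype.val ⁻¹' H) ?_ x.2)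
  rintro ⟨u, _⟩ hu ⟨v, hv⟩ huv
  refine hHcl u hu v (fun hvT => hv ⟨hvT, ?_⟩) huv
  rintro rfl
  exact hno u hu huv

/-- If `T` is a separating triangle of the 3-connected graph `G` and `H` is a
component of `G - T`, then the subgraph `G'` induced on `V(H) ∪ V(T)` has
`K₄` as a minor (contract `H` to a single vertex), so `h(G') ≥ 4`. -/
theorem stmt8 [Finite V] (G : SimpleGraph V) (hG : ThreeConnected G)
    (T : Set V) (hT : G.IsClique T) (hT3 : T.ncard = 3)
    (hdisc : ¬ (G.induce Tᶜ).Connected)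
    (H : Set V) (hHT : H ⊆ Tᶜ) (hHne : H.Nonempty) (hHconn : (G.induce H).Connected)
    (hHcl : ∀ x ∈ H, ∀ y ∈ Tᶜ, G.Adj x y → y ∈ H) :
    IsMinor (⊤ : SimpleGraph (Fin 4)) (G.induce (H ∪ T)) ∧
    4 ≤ hadwigerNumber (G.induce (H ∪ T)) := by
  have hminor : IsMinor (⊤ : SimpleGraph (Fin 4)) (G.induce (H ∪ T)) := by
    have hnbr := fun t (ht : t ∈ T) =>
      hG.exists_adj_of_separating hT3 hdisc hHT hHconn hHcl ht
    let e : Fin 3 ≃ T := (Finite.equivFinOfCardEq hT3).symm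
    have hne : ∀ {i j : Fin 3}, i ≠ j → (e i : V) ≠ e j := fun hij h =>
      hij (e.injective (Subtype.ext h))
    have heH : ∀ i, (e i : V) ∉ H := fun i h => hHT h (e i).2
    refine isMinor_induce_of_subset (Fin.cons H fun i => {(e i : V)}) ?_ ?_ ?_ ?_
    · refine Fin.cases ?_ fun i => ?_
      · exact Set.subset_union_left
      · simp
    · refine Fin.cases hHconn fun i => ?_
      exact Connected.of_subsingleton (V := ({(e i : V)} : Set V))
    · intro i j
      cases i using Fin.cases <;> cases j using Fin.cases <;> intro hij
      · exact absurd rfl hij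
      · simpa using heH _
      · simpa using heH _
      · simpa using hne (by simpa using hij)
    · intro i j
      cases i using Fin.cases <;> cases j using Fin.cases <;> intro hij
      · exact absurd rfl hij
      · simpa using hnbr _ (e _).2
      · simpa [G.adj_comm] using hnbr _ (e _).2
      · simpa using hT (e _).2 (e _).2 (hne (by simpa using hij))
  exact ⟨hminor, hminor.le_hadwigerNumber⟩
end
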